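/- arXiv:1207.7098 — 6 statements merged into one kernel-verified Lean document; each statement's English description precedes it below -/
import Mathlib

section
/- Let p ≥ 1 be an integer and let A = diag(a_1,…,a_p) and B = diag(b_1,…,b_p) be complex diagonal p×p matrices such that a_1,…,a_p are pairwise distinct and b_1,…,b_p are pairwise distinct. Then ∫_{U(p)} exp(tr(A G B G⁻¹)) dG = (∏_{j=1}^{p−1} j!) · det_{1≤i,j≤p}(e^{a_i b_j}) / ( ∏_{1≤i<j≤p}(a_j−a_i) · ∏_{1≤i<j≤p}(b_j−b_i) ). -/
open MeasureTheory Matrix Real Complex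

noncomputable instance (p : ℕ) : MeasurableSpace (Matrix.unitaryGroup (Fin p) ℂ) := borel _

instance (p : ℕ) : BorelSpace (Matrix.unitaryGroup (Fin p) ℂ) := ⟨rfl⟩

section OperatorAlgebra

variable {ι R C M : Type*} [DecidableEq ι] [CommRing R] [CommRing C]
  [AddCommGroup M] [Module R M] [Module C M]

theorem Finset.sum_sum_mem_eq_sum_sum_compl_insert [Fintype ι] (B : Finset ι → ι → M) :
    ∑ V : Finset ι, ∑ l ∈ V, B V l = ∑ V : Finset ι, ∑ j ∈ Vᶜ, B (insert j V) j := by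
  rw [Finset.sum_sigma', Finset.sum_sigma']
  refine Finset.sum_bij' (fun x _ => ⟨x.1.erase x.2, x.2⟩) (fun x _ => ⟨insert x.2 x.1, x.2⟩)
    ?_ ?_ ?_ ?_ ?_
  · rintro ⟨V, l⟩ h; simp
  · rintro ⟨V, l⟩ h; simp
  · rintro ⟨V, l⟩ h
    have : l ∈ V := by simpa using h
    simp [Finset.insert_erase this]
  · rintro ⟨V, l⟩ h
    have : l ∉ V := by simpa using h
    simp [Finset.erase_insert this]
  · rintro ⟨V, l⟩ h
    have : l ∈ V := by simpa using h
    simp [Finset.insert_erase this]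

theorem smul_prod_smul_comm {E : C} {s : Finset ι} {y : ι → R}
    (h : ∀ i ∈ s, ∀ m : M, E • y i • m = y i • E • m) (m : M) :
    E • (∏ i ∈ s, y i) • m = (∏ i ∈ s, y i) • E • m := by
  induction s using Finset.induction_on generalizing m with
  | empty => simp
  | insert i s hi ih =>
    rw [Finset.prod_insert hi, mul_smul, h i (by simp),
      ih (fun j hj => h j (by simp [hj])), mul_smul]

theorem prod_smul_smul_comm {E : ι → C} {s : Finset ι} {y : R}
    (h : ∀ i ∈ s, ∀ m : M, E i • y • m = y • E i • m) (m : M) :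
    (∏ i ∈ s, E i) • y • m = y • (∏ i ∈ s, E i) • m := by
  induction s using Finset.induction_on generalizing m with
  | empty => simp
  | insert i s hi ih =>
    rw [Finset.prod_insert hi, mul_smul, ih (fun j hj => h j (by simp [hj])),
      h i (by simp), mul_smul]

/-- If operators `E i` act on `M` like shifted partial derivatives, `x i j` behaves like
`(a i - a j)⁻¹`, and `E i ψ i = ∑_{j ≠ i} x i j ψ j`, then the product of all the `E i`
annihilates `∑ i, ψ i`. -/
theorem prod_smul_sum_eq_zero [Fintype ι] (E : ι → C) (x : ι → ι → R) (ψ : ι → M)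
    (hcomm : ∀ l i j, l ≠ i → l ≠ j → ∀ m : M, E l • x i j • m = x i j • E l • m)
    (hderiv : ∀ i j, i ≠ j → ∀ m : M, E j • x i j • m = (x i j) ^ 2 • m + x i j • E j • m)
    (hanti : ∀ i j, i ≠ j → x j i = - x i j)
    (hpf : ∀ (V : Finset ι) (j : ι), V.Nonempty → j ∉ V →
      ∑ l ∈ V, (∏ t ∈ V.erase l, x t l) * x l j = ∏ t ∈ V, x t j)
    (hψ : ∀ i, E i • ψ i = ∑ j ∈ Finset.univ.erase i, x i j • ψ j) :
    (∏ i, E i) • ∑ i, ψ i = 0 := by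
  set w : Finset ι → ι → R := fun V l => ∏ t ∈ V.erase l, x t l with hw
  set P : Finset ι → C := fun V => ∏ i ∈ Vᶜ, E i with hP
  set B : Finset ι → ι → M := fun V l => E l • w V l • P V • ψ l with hB
  have hPx : ∀ (V : Finset ι) (i j : ι), i ∈ V → j ∈ V → ∀ m : M,
      P V • x i j • m = x i j • P V • m := by
    intro V i j hi hj m
    refine prod_smul_smul_comm (fun l hl m => hcomm l i j ?_ ?_ m) m
    · rintro rfl; simp at hl; exact hl hi
    · rintro rfl; simp at hl; exact hl hj
  have hwcomm : ∀ (V : Finset ι) (l j : ι), l ∈ V → j ∉ V → ∀ m : M,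
      E j • w V l • m = w V l • E j • m := by
    intro V l j hl hj m
    refine smul_prod_smul_comm (fun t ht m => hcomm j t l ?_ ?_ m) m
    · rintro rfl; exact hj (Finset.mem_of_mem_erase ht)
    · rintro rfl; exact hj hl
  have hPins : ∀ (V : Finset ι) (j : ι), j ∉ V → P V = E j * P (insert j V) := by
    intro V j hj
    simp only [hP]
    rw [Finset.compl_insert, Finset.mul_prod_erase _ _ (by simpa using hj)]
  -- the derivative of a product of simple poles, by partial fractions
  have hdw : ∀ (V : Finset ι) (l : ι), l ∈ V → ∀ m : M,
      E l • w V l • m = w V l • E l • m - ∑ s ∈ V.erase l, (w V s * x s l) • m := by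
    intro V l hl m
    rcases (V.erase l).eq_empty_or_nonempty with h0 | hne
    · simp [hw, h0]
    have hlV : l ∉ V.erase l := by simp
    have key := hpf _ l hne hlV
    have e1 : ∀ m : M, w V l • m = ∑ s ∈ V.erase l, w (V.erase l) s • x s l • m := by
      intro m
      simp only [hw]
      rw [← key, Finset.sum_smul]
      simp only [mul_smul]
    rw [e1, e1, Finset.smul_sum, ← Finset.sum_sub_distrib]
    refine Finset.sum_congr rfl fun s hs => ?_
    have hsl : s ≠ l := Finset.ne_of_mem_erase hs
    have : w V s = x l s * w (V.erase l) s := by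
      simp only [hw]
      rw [Finset.erase_right_comm,
        Finset.mul_prod_erase _ (fun t => x t s) (Finset.mem_erase.2 ⟨hsl.symm, hl⟩)]
    rw [hwcomm _ _ _ hs hlV, hderiv s l hsl, this, hanti s l hsl]
    generalize E l • m = n
    module
  have hA : ∀ V : Finset ι, V.Nonempty →
      ∑ l ∈ V, B V l = ∑ j ∈ Vᶜ, B (insert j V) j := by
    intro V hV
    have e2 : ∀ l ∈ V, B V l = w V l • P V • E l • ψ l
        - ∑ s ∈ V.erase l, (w V s * x s l) • P V • ψ l := by
      intro l hl
      simp only [hB]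
      rw [hdw V l hl, smul_comm (E l) (P V)]
    have e3 : ∀ l ∈ V, w V l • P V • E l • ψ l =
        ∑ j ∈ V.erase l, (w V l * x l j) • P V • ψ j
        + ∑ j ∈ Vᶜ, E j • (w V l * x l j) • P (insert j V) • ψ j := by
      intro l hl
      have hsplit : Finset.univ.erase l = V.erase l ∪ Vᶜ := by
        ext t
        by_cases htl : t = l
        · subst htl; simp [hl]
        · simp [htl, em]
      have hdisj : Disjoint (V.erase l) Vᶜ :=
        Finset.disjoint_left.2 fun t ht => by simpa using Finset.mem_of_mem_erase ht
      rw [hψ, hsplit, Finset.sum_union hdisj, smul_add, smul_add, Finset.smul_sum,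
        Finset.smul_sum, Finset.smul_sum, Finset.smul_sum]
      congr 1
      · refine Finset.sum_congr rfl fun j hj => ?_
        rw [hPx V l j hl (Finset.mem_of_mem_erase hj), mul_smul]
      · refine Finset.sum_congr rfl fun j hj => ?_
        have hj : j ∉ V := by simpa using hj
        rw [hPins V j hj, mul_smul, hPx (insert j V) l j (by simp [hl]) (by simp),
          ← hwcomm V l j hl hj, mul_smul]
    rw [Finset.sum_congr rfl e2, Finset.sum_sub_distrib, Finset.sum_congr rfl e3,
      Finset.sum_add_distrib]
    have e4 : ∑ l ∈ V, ∑ j ∈ V.erase l, (w V l * x l j) • P V • ψ j =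
        ∑ l ∈ V, ∑ s ∈ V.erase l, (w V s * x s l) • P V • ψ l := by
      refine Finset.sum_comm' fun a c => ?_
      simp only [Finset.mem_erase]
      tauto
    rw [e4, add_sub_cancel_left, Finset.sum_comm]
    refine Finset.sum_congr rfl fun j hj => ?_
    have hj : j ∉ V := by simpa using hj
    simp only [hB]
    rw [← Finset.smul_sum, ← Finset.sum_smul, hpf V j hV hj]
    simp [hw, Finset.erase_insert hj]
  have htot := Finset.sum_sum_mem_eq_sum_sum_compl_insert B
  rw [← Finset.sum_erase_add _ _ (Finset.mem_univ ∅), ← Finset.sum_erase_add _ _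
    (Finset.mem_univ (∅ : Finset ι)), Finset.sum_congr rfl fun V hV =>
      hA V (Finset.nonempty_iff_ne_empty.2 (Finset.ne_of_mem_erase hV))] at htot
  have := add_left_cancel htot
  rw [Finset.smul_sum]
  simp only [Finset.sum_empty, Finset.compl_empty] at this
  rw [this]
  refine Finset.sum_congr rfl fun j _ => ?_
  simp only [hB, hw, insert_empty_eq, Finset.erase_singleton, Finset.prod_empty, one_smul]
  rw [← mul_smul, ← LawfulSingleton.insert_empty_eq, ← hPins ∅ j (by simp)]
  simp [hP]

/-- Joint spectral decomposition: if commuting operators `x i` satisfy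
`∏ i, (x i - b k) • φ = 0` for every `k`, the `b k` being distinct, then `φ` is a sum over
permutations `σ` of joint eigenvectors with eigenvalues `b (σ i)`. -/
theorem exists_sum_perm_eigenvectors {K : Type*} [Fintype ι] [Field K] [Algebra K C]
    (x : ι → C) (b : ι → K) (hb : Function.Injective b) (φ : M)
    (h : ∀ k, (∏ i, (x i - algebraMap K C (b k))) • φ = 0) :
    ∃ g : Equiv.Perm ι → M, φ = ∑ σ, g σ ∧
      ∀ σ i, (x i - algebraMap K C (b (σ i))) • g σ = 0 := by
  classical
  have H : ∀ i, (∏ k, (x i - algebraMap K C (b k))) • φ = 0 := by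
    intro i
    set I : Ideal C := LinearMap.ker (LinearMap.toSpanSingleton C M φ) with hI
    have memI : ∀ c, c ∈ I ↔ c • φ = 0 := fun c => by simp [hI]
    rw [← memI, ← Ideal.Quotient.eq_zero_iff_mem]
    rcases subsingleton_or_nontrivial (C ⧸ I) with hs | hn
    · exact Subsingleton.elim _ _
    set q := Ideal.Quotient.mk I
    have hdvd : ∏ k, (Polynomial.X - Polynomial.C (q (algebraMap K C (b k)))) ∣
        ∏ j, (Polynomial.X - Polynomial.C (q (x j))) := by
      refine Finset.prod_dvd_of_coprime ?_ ?_
      · intro k _ l _ hkl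
        refine Polynomial.isCoprime_X_sub_C_of_isUnit_sub ?_
        rw [← map_sub, ← map_sub]
        exact ((sub_ne_zero.2 (hb.ne hkl)).isUnit.map (algebraMap K C)).map q
      · intro k _
        rw [Polynomial.dvd_iff_isRoot, Polynomial.IsRoot, Polynomial.eval_prod]
        simp only [Polynomial.eval_sub, Polynomial.eval_X, Polynomial.eval_C]
        have := (Ideal.Quotient.eq_zero_iff_mem).2 ((memI _).2 (h k))
        rw [map_prod] at this
        simp only [map_sub] at this
        have h2 : ∏ j, (q (algebraMap K C (b k)) - q (x j)) =
            (-1) ^ Fintype.card ι * ∏ j, (q (x j) - q (algebraMap K C (b k))) := by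
          rw [← Finset.card_univ, ← Finset.prod_const, ← Finset.prod_mul_distrib]
          exact Finset.prod_congr rfl fun _ _ => by ring
        rw [h2, this, mul_zero]
    have heq := Polynomial.eq_of_monic_of_dvd_of_natDegree_le
      (Polynomial.monic_prod_of_monic _ _ fun k _ => Polynomial.monic_X_sub_C _)
      (Polynomial.monic_prod_of_monic _ _ fun k _ => Polynomial.monic_X_sub_C _) hdvd (by
        rw [Polynomial.natDegree_prod_of_monic _ _ fun k _ => Polynomial.monic_X_sub_C _,
          Polynomial.natDegree_prod_of_monic _ _ fun k _ => Polynomial.monic_X_sub_C _]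
        simp)
    have := congrArg (Polynomial.eval (q (x i))) heq
    rw [Polynomial.eval_prod, Polynomial.eval_prod] at this
    simp only [Polynomial.eval_sub, Polynomial.eval_X, Polynomial.eval_C] at this
    rw [map_prod]
    simp only [map_sub]
    rw [← this]
    exact Finset.prod_eq_zero (Finset.mem_univ i) (sub_self _)
  set L : ι → ι → C := fun i k => Polynomial.aeval (x i) (Lagrange.basis Finset.univ b k) with hL
  have hL1 : ∀ i, ∑ k, L i k = 1 := by
    intro i
    simp only [hL]
    rw [← map_sum, Lagrange.sum_basis hb.injOn ⟨i, Finset.mem_univ i⟩, map_one]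
  have hL2 : ∀ i k, ∃ c : C, (x i - algebraMap K C (b k)) * L i k =
      c * ∏ l, (x i - algebraMap K C (b l)) := by
    intro i k
    refine ⟨∏ l ∈ Finset.univ.erase k, algebraMap K C (b k - b l)⁻¹, ?_⟩
    rw [← Finset.mul_prod_erase _ _ (Finset.mem_univ k), mul_left_comm]
    congr 1
    simp only [hL, Lagrange.basis, Lagrange.basisDivisor]
    rw [map_prod, ← Finset.prod_mul_distrib]
    simp
  set g : (ι → ι) → M := fun κ => (∏ i, L i (κ i)) • φ with hg
  have hsum : φ = ∑ κ, g κ := by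
    have : ∏ i, ∑ k, L i k = ∑ κ : ι → ι, ∏ i, L i (κ i) := by
      rw [Finset.prod_univ_sum, Fintype.piFinset_univ]
    simp only [hg]
    rw [← Finset.sum_smul, ← this]
    simp [hL1]
  have heig : ∀ κ i, (x i - algebraMap K C (b (κ i))) • g κ = 0 := by
    intro κ i
    obtain ⟨c, hc⟩ := hL2 i (κ i)
    simp only [hg]
    rw [← mul_smul, ← Finset.mul_prod_erase _ _ (Finset.mem_univ i), ← mul_assoc, hc,
      mul_right_comm, mul_smul, H, smul_zero]
  refine ⟨fun σ => g σ, ?_, fun σ i => heig σ i⟩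
  rw [hsum]
  symm
  refine Fintype.sum_of_injective (fun σ : Equiv.Perm ι => (σ : ι → ι)) DFunLike.coe_injective
    _ _ ?_ (fun _ => rfl)
  intro κ hκ
  have hns : ¬ Function.Surjective κ := fun hs =>
    hκ ⟨Equiv.ofBijective κ (Finite.injective_iff_surjective.2 hs |> fun hi => ⟨hi, hs⟩), rfl⟩
  obtain ⟨k, hk⟩ := not_forall.1 hns
  have hk : ∀ i, κ i ≠ k := by simpa using hk
  have hx : ∀ s : Finset ι, (∏ i ∈ s, (x i - algebraMap K C (b k))) • g κ =
      (algebraMap K C (∏ i ∈ s, (b (κ i) - b k))) • g κ := by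
    intro s
    induction s using Finset.induction_on with
    | empty => simp
    | insert i s hi ih =>
      rw [Finset.prod_insert hi, Finset.prod_insert hi, mul_comm, mul_smul,
        mul_comm (b (κ i) - b k), map_mul, mul_smul]
      have : (x i - algebraMap K C (b k)) • g κ = algebraMap K C (b (κ i) - b k) • g κ := by
        rw [← sub_eq_zero, ← sub_smul, map_sub, sub_sub_sub_cancel_right, heig]
      rw [this, smul_comm, ih, smul_comm]
  have h0 := hx Finset.univ
  have hunit : IsUnit (algebraMap K C (∏ i, (b (κ i) - b k))) :=
    (Finset.prod_ne_zero_iff.2 fun i _ => sub_ne_zero.2 (hb.ne (hk i))).isUnit.map _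
  rw [show g κ = (∏ i, L i (κ i)) • φ from rfl, smul_comm, h k, smul_zero] at h0
  exact (hunit.smul_eq_zero).1 h0.symm

end OperatorAlgebra

section SmoothFunctions

variable {ι : Type*} [Fintype ι]

/-- Complex smooth functions on a subset `U` of `ℂ^ι`. -/
def smoothFunctions (U : Set (ι → ℂ)) : Subalgebra ℂ (U → ℂ) where
  carrier := {f | ∃ g : (ι → ℂ) → ℂ, ContDiffOn ℂ (⊤ : ℕ∞) g U ∧ ∀ u : U, f u = g u}
  mul_mem' := by
    rintro _ _ ⟨g, hg, h⟩ ⟨g', hg', h'⟩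
    exact ⟨fun a => g a * g' a, hg.mul hg', fun u => by simp [h, h']⟩
  add_mem' := by
    rintro _ _ ⟨g, hg, h⟩ ⟨g', hg', h'⟩
    exact ⟨fun a => g a + g' a, hg.add hg', fun u => by simp [h, h']⟩
  algebraMap_mem' c := ⟨fun _ => c, contDiffOn_const, fun _ => rfl⟩

namespace smoothFunctions

variable {U : Set (ι → ℂ)}

/-- The restriction to `U` of a function that is smooth on `U`. -/
def mk (g : (ι → ℂ) → ℂ) (hg : ContDiffOn ℂ (⊤ : ℕ∞) g U) : smoothFunctions U :=
  ⟨fun u => g u, g, hg, fun _ => rfl⟩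

theorem exists_eq_mk (f : smoothFunctions U) : ∃ g hg, f = mk g hg := by
  obtain ⟨f, g, hg, h⟩ := f
  exact ⟨g, hg, Subtype.ext (funext h)⟩

theorem mk_congr {g g' : (ι → ℂ) → ℂ} {hg : ContDiffOn ℂ (⊤ : ℕ∞) g U}
    {hg' : ContDiffOn ℂ (⊤ : ℕ∞) g' U} (h : Set.EqOn g g' U) : mk g hg = mk g' hg' :=
  Subtype.ext (funext fun u => h u.2)

theorem contDiffOn_fderiv_apply (hU : IsOpen U) {g : (ι → ℂ) → ℂ}
    (hg : ContDiffOn ℂ (⊤ : ℕ∞) g U) (v : ι → ℂ) :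
    ContDiffOn ℂ (⊤ : ℕ∞) (fun a => fderiv ℂ g a v) U :=
  (hg.fderiv_of_isOpen hU (by simp)).clm_apply contDiffOn_const

variable [DecidableEq ι]

/-- The function underlying `pderiv`. -/
noncomputable def pderivFun (hU : IsOpen U) (i : ι) (f : smoothFunctions U) : smoothFunctions U :=
  mk (fun a => fderiv ℂ f.2.choose a (Pi.single i 1))
    (contDiffOn_fderiv_apply hU f.2.choose_spec.1 _)

theorem pderivFun_mk (hU : IsOpen U) (i : ι) (g : (ι → ℂ) → ℂ)
    (hg : ContDiffOn ℂ (⊤ : ℕ∞) g U) :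
    pderivFun hU i (mk g hg) =
      mk (fun a => fderiv ℂ g a (Pi.single i 1)) (contDiffOn_fderiv_apply hU hg _) := by
  refine mk_congr fun u hu => ?_
  have h1 := (mk g hg).2.choose_spec
  have : (mk g hg).2.choose =ᶠ[nhds u] g := by
    filter_upwards [hU.mem_nhds hu] with v hv
    exact (h1.2 ⟨v, hv⟩).symm
  exact congrArg (fun L => L (Pi.single i 1)) (this.fderiv_eq (𝕜 := ℂ))

/-- The partial derivative with respect to the `i`-th coordinate. -/
noncomputable def pderiv (hU : IsOpen U) (i : ι) : Module.End ℂ (smoothFunctions U) where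
  toFun := pderivFun hU i
  map_add' f f' := by
    obtain ⟨g, hg, rfl⟩ := exists_eq_mk f
    obtain ⟨g', hg', rfl⟩ := exists_eq_mk f'
    have : mk g hg + mk g' hg' = mk (fun a => g a + g' a) (hg.add hg') := rfl
    rw [this, pderivFun_mk, pderivFun_mk, pderivFun_mk]
    refine Subtype.ext (funext fun u => ?_)
    have hu : U ∈ nhds (u : ι → ℂ) := hU.mem_nhds u.2
    have d1 := (hg.contDiffAt hu).differentiableAt (by simp)
    have d2 := (hg'.contDiffAt hu).differentiableAt (by simp)
    exact congrArg (fun L => L (Pi.single i 1)) (fderiv_fun_add d1 d2)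
  map_smul' c f := by
    obtain ⟨g, hg, rfl⟩ := exists_eq_mk f
    have : c • mk g hg = mk (fun a => c • g a) (hg.const_smul c) := rfl
    rw [this, pderivFun_mk, pderivFun_mk]
    refine Subtype.ext (funext fun u => ?_)
    have hu : U ∈ nhds (u : ι → ℂ) := hU.mem_nhds u.2
    have d1 := (hg.contDiffAt hu).differentiableAt (by simp)
    exact congrArg (fun L => L (Pi.single i 1)) (fderiv_fun_const_smul d1 c)

theorem pderiv_mk (hU : IsOpen U) (i : ι) (g : (ι → ℂ) → ℂ) (hg : ContDiffOn ℂ (⊤ : ℕ∞) g U) :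
    pderiv hU i (mk g hg) =
      mk (fun a => fderiv ℂ g a (Pi.single i 1)) (contDiffOn_fderiv_apply hU hg _) :=
  pderivFun_mk hU i g hg

theorem pderiv_mul (hU : IsOpen U) (i : ι) (f f' : smoothFunctions U) :
    pderiv hU i (f * f') = f * pderiv hU i f' + pderiv hU i f * f' := by
  obtain ⟨g, hg, rfl⟩ := exists_eq_mk f
  obtain ⟨g', hg', rfl⟩ := exists_eq_mk f'
  have : mk g hg * mk g' hg' = mk (fun a => g a * g' a) (hg.mul hg') := rfl
  rw [this, pderiv_mk, pderiv_mk, pderiv_mk]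
  refine Subtype.ext (funext fun u => ?_)
  have hu : U ∈ nhds (u : ι → ℂ) := hU.mem_nhds u.2
  have d1 := ((hg.contDiffAt hu).differentiableAt (by simp))
  have d2 := ((hg'.contDiffAt hu).differentiableAt (by simp))
  change fderiv ℂ _ _ _ = g u * fderiv ℂ _ _ _ + fderiv ℂ _ _ _ * g' u
  rw [fderiv_fun_mul d1 d2]
  simp [mul_comm]

theorem pderiv_comm (hU : IsOpen U) (i j : ι) :
    pderiv hU i * pderiv hU j = pderiv hU j * pderiv hU i := by
  ext1 f
  obtain ⟨g, hg, rfl⟩ := exists_eq_mk f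
  rw [Module.End.mul_apply, Module.End.mul_apply, pderiv_mk, pderiv_mk, pderiv_mk, pderiv_mk]
  refine mk_congr fun u hu => ?_
  have hu : U ∈ nhds (u : ι → ℂ) := hU.mem_nhds hu
  have hsymm := (hg.contDiffAt hu).isSymmSndFDerivAt (by
    rw [minSmoothness_of_isRCLikeNormedField]
    exact WithTop.coe_le_coe.2 (le_top (a := (2 : ℕ∞))))
  have hd : DifferentiableAt ℂ (fderiv ℂ g) u :=
    ((hg.contDiffAt hu).fderiv_right (m := 1) (WithTop.coe_le_coe.2
      (le_top (a := (2 : ℕ∞))))).differentiableAt (by simp)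
  rw [fderiv_clm_apply hd (differentiableAt_const _),
    fderiv_clm_apply hd (differentiableAt_const _)]
  simpa using hsymm _ _

end smoothFunctions

end SmoothFunctions

section PartialFractions

theorem sum_prod_inv_sub_mul_inv_sub {ι K : Type*} [DecidableEq ι] [Field K] (v : ι → K) (y : K)
    (V : Finset ι) (hV : V.Nonempty) (hv : Set.InjOn v V) (hy : ∀ t ∈ V, v t ≠ y) :
    ∑ l ∈ V, (∏ t ∈ V.erase l, (v t - v l)⁻¹) * (v l - y)⁻¹ = ∏ t ∈ V, (v t - y)⁻¹ := by
  have hv' : Set.InjOn (fun i => - v i) V := fun i hi j hj h => hv hi hj (neg_injective h)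
  have h := Lagrange.eval_interpolate_not_at_node (s := V) (v := fun i => - v i) (fun _ => 1)
    (x := -y) (fun i hi => by simpa using (hy i hi).symm)
  have h1 : Lagrange.interpolate V (fun i => - v i) (fun _ => 1) = 1 :=
    Lagrange.interpolate_one hv' hV
  rw [h1, Polynomial.eval_one, Lagrange.eval_nodal] at h
  have h2 : ∏ t ∈ V, (-y - -v t) = ∏ t ∈ V, (v t - y) :=
    Finset.prod_congr rfl fun t _ => by ring
  rw [h2] at h
  rw [Finset.prod_inv_distrib, eq_comm, inv_eq_of_mul_eq_one_right h.symm]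
  refine Finset.sum_congr rfl fun l _ => ?_
  rw [Lagrange.nodalWeight, mul_one]
  congr 1
  · exact Finset.prod_congr rfl fun t _ => by ring
  · ring

end PartialFractions

section DifferentialSystem

theorem exists_algHom_mvPolynomial_of_commute {ι K A : Type*} [CommRing K] [Ring A] [Algebra K A]
    (D : ι → A) (hD : ∀ i j, D i * D j = D j * D i) :
    ∃ ρ : MvPolynomial ι K →ₐ[K] A, ∀ i, ρ (MvPolynomial.X i) = D i := by
  have : IsMulCommutative (Algebra.adjoin K (Set.range D)) :=
    Algebra.isMulCommutative_adjoin K (by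
      rintro _ ⟨i, rfl⟩ _ ⟨j, rfl⟩
      exact hD i j)
  let : CommRing (Algebra.adjoin K (Set.range D)) :=
    { (inferInstance : Ring (Algebra.adjoin K (Set.range D))) with
      mul_comm := fun x y => mul_comm' x y }
  let f : MvPolynomial ι K →ₐ[K] Algebra.adjoin K (Set.range D) :=
    MvPolynomial.aeval fun i => ⟨D i, Algebra.subset_adjoin ⟨i, rfl⟩⟩
  refine ⟨(Algebra.adjoin K (Set.range D)).val.comp f, fun i => ?_⟩
  simp [f]

variable {ι : Type*} [Fintype ι] [DecidableEq ι]

theorem eq_const_mul_exp_of_fderiv {U : Set (ι → ℂ)} (hU : IsOpen U) (hc : IsPreconnected U)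
    (β : ι → ℂ) (g : (ι → ℂ) → ℂ) (hg : DifferentiableOn ℂ g U)
    (h : ∀ i, ∀ a ∈ U, fderiv ℂ g a (Pi.single i 1) = β i * g a) :
    ∃ c, ∀ a ∈ U, g a = c * exp (∑ i, β i * a i) := by
  rcases U.eq_empty_or_nonempty with rfl | ⟨a₀, ha₀⟩
  · exact ⟨0, by simp⟩
  have hE : ∀ a : ι → ℂ, HasFDerivAt (fun a : ι → ℂ => exp (-∑ i, β i * a i))
      (exp (-∑ i, β i * a i) • -∑ i, β i •
        ContinuousLinearMap.proj (R := ℂ) (φ := fun _ : ι => ℂ) i) a := by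
    intro a
    refine HasFDerivAt.cexp (HasFDerivAt.neg ?_)
    refine HasFDerivAt.fun_sum fun i _ => ?_
    exact HasFDerivAt.const_mul (ContinuousLinearMap.hasFDerivAt
      (ContinuousLinearMap.proj (R := ℂ) (φ := fun _ : ι => ℂ) i)) (β i)
  have hf : ∀ a ∈ U, HasFDerivAt (fun a : ι → ℂ => g a * exp (-∑ i, β i * a i))
      (0 : (ι → ℂ) →L[ℂ] ℂ) a := by
    intro a ha
    have := ((hg a ha).differentiableAt (hU.mem_nhds ha)).hasFDerivAt.mul (hE a)
    refine this.congr_fderiv ?_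
    refine ContinuousLinearMap.coe_injective (LinearMap.pi_ext' fun i => LinearMap.ext_ring ?_)
    simp [h i a ha, Pi.single_apply]
    ring
  refine ⟨g a₀ * exp (-∑ i, β i * a₀ i), fun a ha => ?_⟩
  have := hU.is_const_of_fderiv_eq_zero hc
    (fun a ha => (hf a ha).differentiableAt.differentiableWithinAt)
    (fun a ha => (hf a ha).fderiv (𝕜 := ℂ)) ha ha₀
  rw [← this, mul_assoc, ← Complex.exp_add, neg_add_cancel, Complex.exp_zero, mul_one]

open smoothFunctions in
/-- If `φ` admits, for every `k`, a decomposition `φ = ∑ i, ψ k i` solving the system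
`∂ᵢ (ψ k i) = b k * ψ k i + ∑_{j ≠ i} (aᵢ - aⱼ)⁻¹ * ψ k j`, then `φ` is a combination of the
exponentials `exp (∑ i, b (σ i) * aᵢ)`. -/
theorem exists_eq_sum_perm_exp {U : Set (ι → ℂ)} (hU : IsOpen U) (hc : IsPreconnected U)
    (hinj : ∀ a ∈ U, Function.Injective a) (b : ι → ℂ) (hb : Function.Injective b)
    (φ : (ι → ℂ) → ℂ) (ψ : ι → ι → (ι → ℂ) → ℂ)
    (hφs : ContDiffOn ℂ (⊤ : ℕ∞) φ U) (hψs : ∀ k i, ContDiffOn ℂ (⊤ : ℕ∞) (ψ k i) U)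
    (hsum : ∀ k, ∀ a ∈ U, ∑ i, ψ k i a = φ a)
    (hψ : ∀ k i, ∀ a ∈ U, fderiv ℂ (ψ k i) a (Pi.single i 1) =
      b k * ψ k i a + ∑ j ∈ Finset.univ.erase i, (a i - a j)⁻¹ * ψ k j a) :
    ∃ c : Equiv.Perm ι → ℂ, ∀ a ∈ U, φ a = ∑ σ, c σ * exp (∑ i, b (σ i) * a i) := by
  obtain ⟨ρ, hρ⟩ := exists_algHom_mvPolynomial_of_commute (K := ℂ) (pderiv hU) (pderiv_comm hU)
  let : Module (MvPolynomial ι ℂ) (smoothFunctions U) :=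
    Module.compHom (smoothFunctions U) ρ.toRingHom
  let D : ι → MvPolynomial ι ℂ := MvPolynomial.X
  have hD : ∀ i (f : smoothFunctions U), D i • f = pderiv hU i f := by
    intro i f
    change ρ (MvPolynomial.X i) f = _
    rw [hρ]
  have hDa : ∀ (z : ℂ) (f : smoothFunctions U),
      algebraMap ℂ (MvPolynomial ι ℂ) z • f = z • f := by
    intro z f
    change ρ (algebraMap ℂ _ z) f = _
    rw [ρ.commutes]
    rfl
  have hxs : ∀ i j, i ≠ j → ContDiffOn ℂ (⊤ : ℕ∞) (fun a : ι → ℂ => (a i - a j)⁻¹) U := by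
    intro i j hij
    refine ContDiffOn.inv (by fun_prop) fun a ha => sub_ne_zero.2 ((hinj a ha).ne hij)
  let x : ι → ι → smoothFunctions U := fun i j =>
    if h : i = j then 0 else mk (fun a : ι → ℂ => (a i - a j)⁻¹) (hxs i j h)
  have hx : ∀ i j, i ≠ j → ∀ u : U, (x i j : U → ℂ) u = ((u : ι → ℂ) i - (u : ι → ℂ) j)⁻¹ := by
    intro i j hij u
    simp only [x, dif_neg hij]
    rfl
  have hDx : ∀ l i j, i ≠ j → ∀ u : U, (pderiv hU l (x i j) : U → ℂ) u =
      -(((Pi.single l 1 : ι → ℂ) i - (Pi.single l 1 : ι → ℂ) j)) *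
        (((u : ι → ℂ) i - (u : ι → ℂ) j)⁻¹) ^ 2 := by
    intro l i j hij u
    simp only [x, dif_neg hij]
    rw [pderiv_mk]
    change fderiv ℂ _ _ _ = _
    have h0 : (u : ι → ℂ) i - (u : ι → ℂ) j ≠ 0 := sub_ne_zero.2 ((hinj u u.2).ne hij)
    have h1 : HasFDerivAt (fun a : ι → ℂ => a i - a j)
        (ContinuousLinearMap.proj (R := ℂ) (φ := fun _ : ι => ℂ) i -
          ContinuousLinearMap.proj (R := ℂ) (φ := fun _ : ι => ℂ) j) (u : ι → ℂ) :=
      (ContinuousLinearMap.proj (R := ℂ) (φ := fun _ : ι => ℂ) i -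
          ContinuousLinearMap.proj (R := ℂ) (φ := fun _ : ι => ℂ) j).hasFDerivAt
    have h2 : HasFDerivAt (fun a : ι → ℂ => (a i - a j)⁻¹) _ (u : ι → ℂ) :=
      (hasDerivAt_inv h0).comp_hasFDerivAt (u : ι → ℂ) h1
    rw [h2.fderiv]
    simp
    ring
  have hleib : ∀ (l : ι) (z : ℂ) (y m : smoothFunctions U),
      (D l - algebraMap ℂ (MvPolynomial ι ℂ) z) • y • m =
        pderiv hU l y • m + y • (D l - algebraMap ℂ (MvPolynomial ι ℂ) z) • m := by
    intro l z y m
    rw [sub_smul, sub_smul, hD, hDa, hD, hDa, smul_eq_mul, smul_eq_mul, smul_eq_mul, pderiv_mul,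
      mul_sub, mul_smul_comm]
    ring
  have hcoe : ∀ (s : Finset ι) (f : ι → smoothFunctions U) (u : U),
      ((∑ i ∈ s, f i : smoothFunctions U) : U → ℂ) u = ∑ i ∈ s, (f i : U → ℂ) u := by
    intro s f u
    rw [AddSubmonoidClass.coe_finsetSum, Finset.sum_apply]
  have hcoep : ∀ (s : Finset ι) (f : ι → smoothFunctions U) (u : U),
      ((∏ i ∈ s, f i : smoothFunctions U) : U → ℂ) u = ∏ i ∈ s, (f i : U → ℂ) u := by
    intro s f u
    rw [SubmonoidClass.coe_finsetProd, Finset.prod_apply]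
  have hann : ∀ k, (∏ i, (D i - algebraMap ℂ (MvPolynomial ι ℂ) (b k))) • mk φ hφs = 0 := by
    intro k
    have hs : mk φ hφs = ∑ i, mk (ψ k i) (hψs k i) := by
      refine Subtype.ext (funext fun u => ?_)
      rw [hcoe]
      exact (hsum k u u.2).symm
    rw [hs]
    refine prod_smul_sum_eq_zero (fun i => D i - algebraMap ℂ (MvPolynomial ι ℂ) (b k)) x
      (fun i => mk (ψ k i) (hψs k i)) ?_ ?_ ?_ ?_ ?_
    · intro l i j hli hlj m
      rw [hleib]
      have : pderiv hU l (x i j) = 0 := by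
        by_cases hij : i = j
        · simp [x, hij]
        refine Subtype.ext (funext fun u => ?_)
        rw [hDx l i j hij]
        simp [hli.symm, hlj.symm]
      rw [this, zero_smul, zero_add]
    · intro i j hij m
      rw [hleib]
      have : pderiv hU j (x i j) = x i j ^ 2 := by
        refine Subtype.ext (funext fun u => ?_)
        rw [hDx j i j hij]
        change _ = ((x i j : U → ℂ) u) ^ 2
        rw [hx i j hij]
        simp [hij]
      rw [this]
    · intro i j hij
      refine Subtype.ext (funext fun u => ?_)
      change _ = -((x i j : U → ℂ) u)
      rw [hx i j hij, hx j i hij.symm, ← inv_neg, neg_sub]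
    · intro V j hV hj
      refine Subtype.ext (funext fun u => ?_)
      rw [hcoe, hcoep]
      have hu := hinj u u.2
      have hne : ∀ t ∈ V, t ≠ j := fun t ht h => hj (h ▸ ht)
      rw [Finset.prod_congr rfl fun t ht => hx t j (hne t ht) u,
        ← sum_prod_inv_sub_mul_inv_sub (u : ι → ℂ) _ V hV hu.injOn
          fun t ht => hu.ne (hne t ht)]
      refine Finset.sum_congr rfl fun l hl => ?_
      rw [MulMemClass.coe_mul, Pi.mul_apply, hcoep, hx l j (hne l hl),
        Finset.prod_congr rfl fun t ht => hx t l (Finset.ne_of_mem_erase ht) u]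
    · intro i
      refine Subtype.ext (funext fun u => ?_)
      rw [hcoe, sub_smul, hD, hDa, pderiv_mk]
      change fderiv ℂ (ψ k i) u (Pi.single i 1) - b k * ψ k i u = _
      rw [hψ k i u u.2, add_sub_cancel_left]
      refine Finset.sum_congr rfl fun j hj => ?_
      change _ = (x i j : U → ℂ) u * ψ k j u
      rw [hx i j (Finset.ne_of_mem_erase hj).symm]
  obtain ⟨g, hg, heig⟩ := exists_sum_perm_eigenvectors D b hb (mk φ hφs) hann
  have hsol : ∀ σ, ∃ c, ∀ u : U, (g σ : U → ℂ) u = c * exp (∑ i, b (σ i) * (u : ι → ℂ) i) := by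
    intro σ
    obtain ⟨f, hf, hgf⟩ := exists_eq_mk (g σ)
    obtain ⟨c, hc⟩ := eq_const_mul_exp_of_fderiv hU hc (fun i => b (σ i)) f
      (hf.differentiableOn (by simp)) (by
        intro i a ha
        have h1 := heig σ i
        rw [hgf, sub_smul, hD, hDa, pderiv_mk, sub_eq_zero] at h1
        exact congrFun (congrArg Subtype.val h1) ⟨a, ha⟩)
    exact ⟨c, fun u => by rw [hgf]; exact hc u u.2⟩
  choose c hc using hsol
  refine ⟨c, fun a ha => ?_⟩
  have h1 := congrFun (congrArg Subtype.val hg) ⟨a, ha⟩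
  rw [AddSubmonoidClass.coe_finsetSum, Finset.sum_apply] at h1
  rw [Finset.sum_congr rfl fun σ _ => (hc σ ⟨a, ha⟩).symm]
  exact h1

end DifferentialSystem

section ParametricIntegral

variable {X : Type*} [TopologicalSpace X] [CompactSpace X] [MeasurableSpace X] [BorelSpace X]
  {μ : Measure X} [IsFiniteMeasure μ]

theorem Continuous.integrable_of_compactSpace {F : Type*} [NormedAddCommGroup F] {f : X → F}
    (hf : Continuous f) : Integrable f μ :=
  hf.integrable_of_hasCompactSupport (HasCompactSupport.of_compactSpace f)

theorem hasFDerivAt_integral_of_continuous {𝕜 E : Type*} [RCLike 𝕜] [NormedAddCommGroup E]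
    [NormedSpace 𝕜 E] [ProperSpace E] {f : E → X → ℂ} [NormedSpace 𝕜 ℂ]
    {f' : E → X → E →L[𝕜] ℂ} (hf : ∀ e, Continuous (f e))
    (hf' : Continuous (Function.uncurry f'))
    (h : ∀ e x, HasFDerivAt (fun e => f e x) (f' e x) e) (e₀ : E) :
    HasFDerivAt (fun e => ∫ x, f e x ∂μ) (∫ x, f' e₀ x ∂μ) e₀ := by
  obtain ⟨C, hC⟩ := ((isCompact_closedBall e₀ 1).prod isCompact_univ).exists_bound_of_continuousOn
    (f := Function.uncurry f') hf'.continuousOn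
  refine hasFDerivAt_integral_of_dominated_of_fderiv_le (bound := fun _ => C)
    (Metric.ball_mem_nhds e₀ one_pos) ?_ ?_ ?_ ?_ ?_ ?_
  · exact Filter.Eventually.of_forall fun e =>
      (hf e).integrable_of_compactSpace.aestronglyMeasurable
  · exact (hf e₀).integrable_of_compactSpace
  · exact (Continuous.integrable_of_compactSpace
      (hf'.comp (Continuous.prodMk_right e₀))).aestronglyMeasurable
  · exact Filter.Eventually.of_forall fun x e he =>
      hC (e, x) ⟨Metric.ball_subset_closedBall he, Set.mem_univ x⟩
  · exact integrable_const C
  · exact Filter.Eventually.of_forall fun x e _ => h e x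

variable {ι : Type*} [Fintype ι]

theorem hasFDerivAt_integral_mul_exp {y : ι → X → ℂ} (hy : ∀ i, Continuous (y i)) {h : X → ℂ}
    (hh : Continuous h) (a : ι → ℂ) :
    HasFDerivAt (fun a : ι → ℂ => ∫ x, h x * exp (∑ i, a i * y i x) ∂μ)
      (∑ i, (∫ x, h x * y i x * exp (∑ i, a i * y i x) ∂μ) •
        ContinuousLinearMap.proj (R := ℂ) (φ := fun _ : ι => ℂ) i) a := by
  have key := hasFDerivAt_integral_of_continuous (μ := μ) (𝕜 := ℂ)
    (f := fun (a : ι → ℂ) x => h x * exp (∑ i, a i * y i x))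
    (f' := fun a x => ∑ i, (h x * y i x * exp (∑ i, a i * y i x)) •
        ContinuousLinearMap.proj (R := ℂ) (φ := fun _ : ι => ℂ) i)
    (fun a => by fun_prop) (by unfold Function.uncurry; fun_prop) (by
      intro a x
      have h1 : HasFDerivAt (fun a : ι → ℂ => ∑ i, a i * y i x)
          (∑ i, y i x • ContinuousLinearMap.proj (R := ℂ) (φ := fun _ : ι => ℂ) i) a :=
        HasFDerivAt.fun_sum fun i _ => (ContinuousLinearMap.hasFDerivAt
          (ContinuousLinearMap.proj (R := ℂ) (φ := fun _ : ι => ℂ) i)).mul_const (y i x)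
      refine (h1.cexp.const_mul (h x)).congr_fderiv ?_
      simp only [Finset.smul_sum, smul_smul]
      refine Finset.sum_congr rfl fun i _ => ?_
      congr 1
      ring) a
  refine key.congr_fderiv ?_
  rw [integral_finsetSum]
  · exact Finset.sum_congr rfl fun i _ => integral_smul_const _ _
  · intro i _
    exact Continuous.integrable_of_compactSpace (by fun_prop)

theorem contDiff_integral_mul_exp {y : ι → X → ℂ} (hy : ∀ i, Continuous (y i)) {h : X → ℂ}
    (hh : Continuous h) :
    ContDiff ℂ (⊤ : ℕ∞) (fun a : ι → ℂ => ∫ x, h x * exp (∑ i, a i * y i x) ∂μ) := by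
  refine contDiff_infty.2 fun n => ?_
  induction n generalizing h with
  | zero =>
    exact contDiff_zero.2 (continuous_iff_continuousAt.2 fun a =>
      (hasFDerivAt_integral_mul_exp hy hh a).continuousAt)
  | succ n ih =>
    have := funext fun a => (hasFDerivAt_integral_mul_exp (μ := μ) hy hh a).fderiv
    refine (contDiff_succ_iff_fderiv (n := n)).2 ⟨fun a =>
      (hasFDerivAt_integral_mul_exp hy hh a).differentiableAt, by simp, ?_⟩
    rw [this]
    exact ContDiff.sum fun i _ => (ih (hh.mul (hy i))).smul contDiff_const

end ParametricIntegral

namespace Matrix.unitaryGroup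

section Basic

variable {n : Type*} [Fintype n] [DecidableEq n]

instance : CompactSpace (unitaryGroup n ℂ) := by
  refine isCompact_iff_compactSpace.1 (IsCompact.of_isClosed_subset
    (isCompact_univ_pi fun _ : n => isCompact_univ_pi fun _ : n =>
      isCompact_closedBall (0 : ℂ) 1) ?_ ?_)
  · have : (unitaryGroup n ℂ : Set (Matrix n n ℂ)) = {A | A * star A = 1} := by
      ext A
      exact mem_unitaryGroup_iff
    rw [this]
    exact isClosed_eq (by fun_prop) continuous_const
  · intro A hA i _ j _
    simpa using entry_norm_bound_of_unitary hA i j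

theorem continuous_entry (i j : n) :
    Continuous fun G : unitaryGroup n ℂ => (G : Matrix n n ℂ) i j :=
  continuous_subtype_val.matrix_elem i j

theorem sum_star_col_mul_col (G : unitaryGroup n ℂ) (k l : n) :
    ∑ j, star ((G : Matrix n n ℂ) j k) * (G : Matrix n n ℂ) j l = if k = l then 1 else 0 := by
  have h := congrFun (congrFun (mem_unitaryGroup_iff'.1 G.2) k) l
  rwa [Matrix.mul_apply, Matrix.one_apply] at h

/-- The rotation by the angle `θ` in the plane spanned by the coordinates `i` and `j`. -/
noncomputable def rotation {i j : n} (hij : i ≠ j) (θ : ℝ) : unitaryGroup n ℂ :=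
  ⟨1 + (cos (θ : ℂ) - 1) • (single i i (1 : ℂ) + single j j 1)
      + sin (θ : ℂ) • (single i j (1 : ℂ) - single j i 1), by
    have hc : star (cos (θ : ℂ)) = cos (θ : ℂ) := by
      rw [← Complex.ofReal_cos]; exact Complex.conj_ofReal _
    have hs : star (sin (θ : ℂ)) = sin (θ : ℂ) := by
      rw [← Complex.ofReal_sin]; exact Complex.conj_ofReal _
    set P : Matrix n n ℂ := single i i (1 : ℂ) + single j j 1
    set J : Matrix n n ℂ := single i j (1 : ℂ) - single j i 1
    have hP : star P = P := by simp [P, star_eq_conjTranspose]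
    have hJ : star J = -J := by simp [J, star_eq_conjTranspose]
    have hPP : P * P = P := by simp [P, add_mul, mul_add, hij, hij.symm]
    have hJJ : J * J = -P := by
      simp [P, J, sub_mul, mul_sub, hij, hij.symm]
      abel
    have hPJ : P * J = J := by
      simp [P, J, add_mul, mul_sub, hij, hij.symm]
    have hJP : J * P = J := by
      simp [P, J, sub_mul, mul_add, hij, hij.symm]
      abel
    rw [mem_unitaryGroup_iff]
    simp only [star_add, star_one, star_smul, star_sub, hP, hJ, hc, hs, add_mul, mul_add,
      smul_mul_assoc, mul_smul_comm, mul_neg, hPP, hJJ, hPJ, hJP, one_mul, mul_one]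
    clear_value P J
    match_scalars
    · ring
    · linear_combination Complex.sin_sq_add_cos_sq (θ : ℂ)
    · ring⟩

theorem rotation_mul_apply_left {i j : n} (hij : i ≠ j) (θ : ℝ) (G : unitaryGroup n ℂ) (m : n) :
    ((rotation hij θ * G : unitaryGroup n ℂ) : Matrix n n ℂ) i m =
      cos (θ : ℂ) * (G : Matrix n n ℂ) i m + sin (θ : ℂ) * (G : Matrix n n ℂ) j m := by
  simp [rotation, add_mul, sub_mul, hij]

theorem rotation_mul_apply_right {i j : n} (hij : i ≠ j) (θ : ℝ) (G : unitaryGroup n ℂ) (m : n) :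
    ((rotation hij θ * G : unitaryGroup n ℂ) : Matrix n n ℂ) j m =
      cos (θ : ℂ) * (G : Matrix n n ℂ) j m - sin (θ : ℂ) * (G : Matrix n n ℂ) i m := by
  simp [rotation, add_mul, sub_mul, hij.symm]
  ring

theorem rotation_mul_apply_of_ne {i j l : n} (hij : i ≠ j) (hi : l ≠ i) (hj : l ≠ j) (θ : ℝ)
    (G : unitaryGroup n ℂ) (m : n) :
    ((rotation hij θ * G : unitaryGroup n ℂ) : Matrix n n ℂ) l m = (G : Matrix n n ℂ) l m := by
  simp [rotation, add_mul, sub_mul, hi, hj]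

theorem continuous_rotation {i j : n} (hij : i ≠ j) : Continuous (rotation hij) := by
  unfold rotation
  fun_prop

/-- Multiplication of the row `i` by the imaginary unit. -/
noncomputable def rowPhase (i : n) : unitaryGroup n ℂ :=
  ⟨diagonal (Function.update 1 i I), by
    rw [mem_unitaryGroup_iff, star_eq_conjTranspose, diagonal_conjTranspose, diagonal_mul_diagonal,
      ← diagonal_one]
    congr 1
    ext l
    by_cases h : l = i <;> simp [h]⟩

theorem rowPhase_mul_apply (i l m : n) (G : unitaryGroup n ℂ) :
    ((rowPhase i * G : unitaryGroup n ℂ) : Matrix n n ℂ) l m =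
      Function.update (1 : n → ℂ) i I l * (G : Matrix n n ℂ) l m :=
  diagonal_mul _ _ _ _

/-- The permutation matrix of `τ`, as a unitary matrix. -/
noncomputable def permutation (τ : Equiv.Perm n) : unitaryGroup n ℂ :=
  ⟨τ.permMatrix ℂ, by
    rw [mem_unitaryGroup_iff, star_eq_conjTranspose, conjTranspose_permMatrix,
      ← permMatrix_mul, inv_mul_cancel, permMatrix_one]⟩

theorem permutation_mul_apply (τ : Equiv.Perm n) (G : unitaryGroup n ℂ) (l m : n) :
    ((permutation τ * G : unitaryGroup n ℂ) : Matrix n n ℂ) l m = (G : Matrix n n ℂ) (τ l) m := by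
  simp [permutation, Equiv.Perm.permMatrix, PEquiv.toMatrix_toPEquiv_mul]

end Basic

end Matrix.unitaryGroup

namespace Matrix.unitaryGroup

section Integral

variable {p : ℕ}

/-- The matrix entry `(l, m)` of `G * diagonal b * G⁻¹`. -/
noncomputable def conjDiag (b : Fin p → ℂ) (l m : Fin p) (G : unitaryGroup (Fin p) ℂ) : ℂ :=
  ∑ n, b n * ((G : Matrix (Fin p) (Fin p) ℂ) l n * star ((G : Matrix (Fin p) (Fin p) ℂ) m n))

/-- The matrix entry `(i, j)` of the orthogonal projection onto the column `k` of `G`. -/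
noncomputable def colProj (k i j : Fin p) (G : unitaryGroup (Fin p) ℂ) : ℂ :=
  (G : Matrix (Fin p) (Fin p) ℂ) i k * star ((G : Matrix (Fin p) (Fin p) ℂ) j k)

/-- The Boltzmann weight `exp (tr (diagonal a * G * diagonal b * G⁻¹))`. -/
noncomputable def weight (a b : Fin p → ℂ) (G : unitaryGroup (Fin p) ℂ) : ℂ :=
  exp (∑ i, a i * conjDiag b i i G)

theorem continuous_conjDiag (b : Fin p → ℂ) (l m : Fin p) : Continuous (conjDiag b l m) :=
  continuous_finsetSum _ fun n _ => continuous_const.mul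
    ((continuous_entry l n).mul (continuous_entry m n).star)

theorem continuous_colProj (k i j : Fin p) : Continuous (colProj k i j) :=
  (continuous_entry i k).mul (continuous_entry j k).star

theorem continuous_weight (a b : Fin p → ℂ) : Continuous (weight a b) :=
  Complex.continuous_exp.comp (continuous_finsetSum _ fun i _ =>
    continuous_const.mul (continuous_conjDiag b i i))

theorem trace_diagonal_mul_conj (a b : Fin p → ℂ) (G : unitaryGroup (Fin p) ℂ) :
    trace (diagonal a * (G : Matrix (Fin p) (Fin p) ℂ) * diagonal b *
      ((G⁻¹ : unitaryGroup (Fin p) ℂ) : Matrix (Fin p) (Fin p) ℂ)) =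
      ∑ i, a i * conjDiag b i i G := by
  simp only [trace, diag_apply]
  refine Finset.sum_congr rfl fun i _ => ?_
  rw [Matrix.mul_apply, conjDiag, Finset.mul_sum]
  refine Finset.sum_congr rfl fun n _ => ?_
  rw [mul_diagonal, diagonal_mul]
  change _ * star ((G : Matrix (Fin p) (Fin p) ℂ) i n) = _
  ring

theorem sum_colProj_self (k : Fin p) (G : unitaryGroup (Fin p) ℂ) : ∑ i, colProj k i i G = 1 := by
  have := sum_star_col_mul_col G k k
  rw [if_pos rfl] at this
  rw [← this]
  exact Finset.sum_congr rfl fun i _ => mul_comm _ _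

theorem sum_colProj_mul_conjDiag (b : Fin p → ℂ) (k i : Fin p) (G : unitaryGroup (Fin p) ℂ) :
    ∑ j, colProj k i j G * conjDiag b j i G = b k * colProj k i i G := by
  simp only [colProj, conjDiag, Finset.mul_sum]
  rw [Finset.sum_comm]
  have : ∀ n, ∑ j, (G : Matrix (Fin p) (Fin p) ℂ) i k * star ((G : Matrix (Fin p) (Fin p) ℂ) j k) *
      (b n * ((G : Matrix (Fin p) (Fin p) ℂ) j n * star ((G : Matrix (Fin p) (Fin p) ℂ) i n))) =
      (G : Matrix (Fin p) (Fin p) ℂ) i k * b n * star ((G : Matrix (Fin p) (Fin p) ℂ) i n) *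
        if k = n then 1 else 0 := by
    intro n
    rw [← sum_star_col_mul_col G k n, Finset.mul_sum]
    exact Finset.sum_congr rfl fun j _ => by ring
  simp only [this]
  simp
  ring

theorem hasDerivAt_rotation_mul_apply {i j : Fin p} (hij : i ≠ j) (G : unitaryGroup (Fin p) ℂ)
    (θ : ℝ) (l m : Fin p) :
    HasDerivAt (fun θ => ((rotation hij θ * G : unitaryGroup (Fin p) ℂ) :
        Matrix (Fin p) (Fin p) ℂ) l m)
      (((Pi.single i 1 : Fin p → ℂ) l) * ((rotation hij θ * G : unitaryGroup (Fin p) ℂ) :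
        Matrix (Fin p) (Fin p) ℂ) j m - ((Pi.single j 1 : Fin p → ℂ) l) *
        ((rotation hij θ * G : unitaryGroup (Fin p) ℂ) : Matrix (Fin p) (Fin p) ℂ) i m) θ := by
  have hc : HasDerivAt (fun θ : ℝ => cos (θ : ℂ)) (-sin (θ : ℂ)) θ :=
    (Complex.hasDerivAt_cos _).comp_ofReal
  have hs : HasDerivAt (fun θ : ℝ => sin (θ : ℂ)) (cos (θ : ℂ)) θ :=
    (Complex.hasDerivAt_sin _).comp_ofReal
  rw [rotation_mul_apply_left, rotation_mul_apply_right]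
  by_cases hi : l = i
  · subst hi
    simp only [rotation_mul_apply_left]
    refine ((hc.mul_const _).add (hs.mul_const _)).congr_deriv ?_
    simp [hij]
    ring
  by_cases hj : l = j
  · subst hj
    simp only [rotation_mul_apply_right]
    refine ((hc.mul_const _).sub (hs.mul_const _)).congr_deriv ?_
    simp [hi]
    ring
  · simp only [rotation_mul_apply_of_ne hij hi hj]
    refine (hasDerivAt_const _ _).congr_deriv ?_
    simp [hi, hj]

theorem hasDerivAt_rotation_colProj {i j : Fin p} (hij : i ≠ j)
    (G : unitaryGroup (Fin p) ℂ) (θ : ℝ) (l l' m : Fin p) :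
    HasDerivAt (fun θ => colProj m l l' (rotation hij θ * G))
      ((Pi.single i 1 : Fin p → ℂ) l * colProj m j l' (rotation hij θ * G) -
        (Pi.single j 1 : Fin p → ℂ) l * colProj m i l' (rotation hij θ * G) +
        ((Pi.single i 1 : Fin p → ℂ) l' * colProj m l j (rotation hij θ * G) -
        (Pi.single j 1 : Fin p → ℂ) l' * colProj m l i (rotation hij θ * G))) θ := by
  refine ((hasDerivAt_rotation_mul_apply hij G θ l m).mul
    (hasDerivAt_rotation_mul_apply hij G θ l' m).star).congr_deriv ?_
  have hst : ∀ i l : Fin p,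
      star ((Pi.single i 1 : Fin p → ℂ) l) = (Pi.single i 1 : Fin p → ℂ) l := by
    intro i l
    by_cases h : l = i
    · subst h; simp
    · simp [h]
  simp only [star_sub, star_mul', hst, colProj]
  ring

theorem conjDiag_eq_sum_colProj (b : Fin p → ℂ) (l m : Fin p) (G : unitaryGroup (Fin p) ℂ) :
    conjDiag b l m G = ∑ n, b n * colProj n l m G := rfl

theorem hasDerivAt_rotation_conjDiag {i j : Fin p} (hij : i ≠ j) (b : Fin p → ℂ)
    (G : unitaryGroup (Fin p) ℂ) (θ : ℝ) (l : Fin p) :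
    HasDerivAt (fun θ => conjDiag b l l (rotation hij θ * G))
      (((Pi.single i 1 : Fin p → ℂ) l - (Pi.single j 1 : Fin p → ℂ) l) *
        (conjDiag b i j (rotation hij θ * G) + conjDiag b j i (rotation hij θ * G))) θ := by
  simp only [conjDiag_eq_sum_colProj]
  refine (HasDerivAt.fun_sum fun n _ =>
    (hasDerivAt_rotation_colProj hij G θ l l n).const_mul (b n)).congr_deriv ?_
  rw [← Finset.sum_add_distrib, Finset.mul_sum]
  refine Finset.sum_congr rfl fun n _ => ?_
  by_cases hi : l = i
  · subst hi
    simp [hij]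
    ring
  by_cases hj : l = j
  · subst hj
    simp [hi]
    ring
  · simp [hi, hj]

variable (μ : Measure (unitaryGroup (Fin p) ℂ)) [μ.IsMulLeftInvariant]

/-- The Schwinger–Dyson equation expressing invariance of `μ` under infinitesimal rotations. -/
theorem integral_schwinger_dyson [IsFiniteMeasure μ] (a b : Fin p → ℂ)
    (k : Fin p) {i j : Fin p} (hij : i ≠ j) :
    ∫ G, (colProj k j j G - colProj k i i G + colProj k i j G * ((a i - a j) *
      (conjDiag b i j G + conjDiag b j i G))) * weight a b G ∂μ = 0 := by
  set f' : unitaryGroup (Fin p) ℂ → ℂ := fun G =>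
    (colProj k j j G - colProj k i i G + colProj k i j G * ((a i - a j) *
      (conjDiag b i j G + conjDiag b j i G))) * weight a b G with hf'
  have hcol := continuous_colProj (p := p) k
  have hconj := continuous_conjDiag (p := p) b
  have hw := continuous_weight (p := p) a b
  have hc' : Continuous f' := by fun_prop
  have hR := continuous_rotation hij
  have hd : ∀ (θ : ℝ) G, HasDerivAt (fun θ => colProj k i j (rotation hij θ * G) *
      weight a b (rotation hij θ * G)) (f' (rotation hij θ * G)) θ := by
    intro θ G
    have h1 := hasDerivAt_rotation_colProj hij G θ i j k
    have h2 := (HasDerivAt.fun_sum fun l (_ : l ∈ Finset.univ) =>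
      (hasDerivAt_rotation_conjDiag hij b G θ l).const_mul (a l)).cexp
    refine (h1.mul h2).congr_deriv ?_
    have h3 : ∀ z : ℂ, ∑ l, a l * (((Pi.single i 1 : Fin p → ℂ) l -
        (Pi.single j 1 : Fin p → ℂ) l) * z) = (a i - a j) * z := by
      intro z
      simp [sub_mul, mul_sub, Finset.sum_sub_distrib, Pi.single_apply]
    rw [h3]
    simp only [hf', weight]
    simp [hij, hij.symm]
    ring
  have key := hasFDerivAt_integral_of_continuous (μ := μ) (𝕜 := ℝ)
    (f := fun (θ : ℝ) G => colProj k i j (rotation hij θ * G) * weight a b (rotation hij θ * G))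
    (f' := fun θ G => ContinuousLinearMap.toSpanSingleton ℝ (f' (rotation hij θ * G)))
    (fun θ => by fun_prop)
    ((ContinuousLinearMap.toSpanSingletonCLE (𝕜 := ℝ) (E := ℂ)).continuous.comp
      (hc'.comp (by fun_prop)))
    (fun θ G => (hd θ G).hasFDerivAt) 0
  have hconst : (fun θ => ∫ G, colProj k i j (rotation hij θ * G) *
      weight a b (rotation hij θ * G) ∂μ) = fun _ => ∫ G, colProj k i j G * weight a b G ∂μ :=
    funext fun θ => integral_mul_left_eq_self (fun G => colProj k i j G * weight a b G) _
  rw [hconst] at key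
  have h0 := key.unique (hasFDerivAt_const _ _)
  have h1 : (∫ G, ContinuousLinearMap.toSpanSingleton ℝ (f' (rotation hij 0 * G)) ∂μ) 1 = 0 := by
    rw [h0]
    rfl
  rw [ContinuousLinearMap.integral_apply] at h1
  · simpa [integral_mul_left_eq_self f'] using h1
  · exact Continuous.integrable_of_compactSpace
      ((ContinuousLinearMap.toSpanSingletonCLE (𝕜 := ℝ) (E := ℂ)).continuous.comp
        (hc'.comp (by fun_prop)))

theorem integral_colProj_mul_conjDiag_eq_zero (a b : Fin p → ℂ) (k : Fin p) {i j : Fin p}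
    (hij : i ≠ j) :
    ∫ G, colProj k i j G * conjDiag b i j G * weight a b G ∂μ = 0 := by
  set f : unitaryGroup (Fin p) ℂ → ℂ := fun G =>
    colProj k i j G * conjDiag b i j G * weight a b G with hf
  have hcol : ∀ (G : unitaryGroup (Fin p) ℂ) m,
      colProj m i j (rowPhase i * G) = I * colProj m i j G := by
    intro G m
    simp only [colProj, rowPhase_mul_apply]
    simp [hij.symm]
    ring
  have hdiag : ∀ (G : unitaryGroup (Fin p) ℂ) m l,
      colProj m l l (rowPhase i * G) = colProj m l l G := by
    intro G m l
    simp only [colProj, rowPhase_mul_apply]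
    by_cases h : l = i
    · subst h
      simp only [Function.update_self, star_mul', Complex.star_def, Complex.conj_I]
      linear_combination (-(G : Matrix (Fin p) (Fin p) ℂ) l m *
        (starRingEnd ℂ) ((G : Matrix (Fin p) (Fin p) ℂ) l m)) * Complex.I_mul_I
    · simp [h]
  have hneg : ∀ G, f (rowPhase i * G) = -f G := by
    intro G
    have hw : weight a b (rowPhase i * G) = weight a b G := by
      simp only [weight, conjDiag_eq_sum_colProj, hdiag]
    have hc : conjDiag b i j (rowPhase i * G) = I * conjDiag b i j G := by
      simp only [conjDiag_eq_sum_colProj, hcol, Finset.mul_sum]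
      exact Finset.sum_congr rfl fun n _ => by ring
    simp only [hf, hw, hc, hcol]
    linear_combination (colProj k i j G * conjDiag b i j G * weight a b G) * Complex.I_mul_I
  have h := integral_mul_left_eq_self (μ := μ) f (rowPhase i)
  simp only [hneg, integral_neg] at h
  linear_combination (-1 / 2 : ℂ) * h

theorem sub_mul_integral_colProj_mul_conjDiag [IsFiniteMeasure μ] (a b : Fin p → ℂ)
    (k : Fin p) {i j : Fin p}
    (hij : i ≠ j) :
    (a i - a j) * ∫ G, colProj k i j G * conjDiag b j i G * weight a b G ∂μ =
      ∫ G, colProj k i i G * weight a b G ∂μ - ∫ G, colProj k j j G * weight a b G ∂μ := by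
  have hcol := continuous_colProj (p := p) k
  have hconj := continuous_conjDiag (p := p) b
  have hw := continuous_weight (p := p) a b
  have h1 := integral_schwinger_dyson μ a b k hij
  have h2 := integral_colProj_mul_conjDiag_eq_zero μ a b k hij
  have h3 : ∀ G, (colProj k j j G - colProj k i i G + colProj k i j G * ((a i - a j) *
      (conjDiag b i j G + conjDiag b j i G))) * weight a b G =
      colProj k j j G * weight a b G - colProj k i i G * weight a b G +
      ((a i - a j) * (colProj k i j G * conjDiag b i j G * weight a b G) +
        (a i - a j) * (colProj k i j G * conjDiag b j i G * weight a b G)) := fun G => by ring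
  simp only [h3] at h1
  rw [integral_add, integral_sub, integral_add, integral_const_mul, integral_const_mul, h2] at h1
  · linear_combination h1
  all_goals exact Continuous.integrable_of_compactSpace (by fun_prop)

theorem integral_colProj_self_mul_conjDiag [IsFiniteMeasure μ] (a b : Fin p → ℂ)
    (ha : Function.Injective a)
    (k i : Fin p) :
    ∫ G, colProj k i i G * conjDiag b i i G * weight a b G ∂μ =
      b k * ∫ G, colProj k i i G * weight a b G ∂μ -
        ∑ j ∈ Finset.univ.erase i, (a i - a j)⁻¹ *
          (∫ G, colProj k i i G * weight a b G ∂μ - ∫ G, colProj k j j G * weight a b G ∂μ) := by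
  have hcol := continuous_colProj (p := p) k
  have hconj := continuous_conjDiag (p := p) b
  have hw := continuous_weight (p := p) a b
  have h1 : ∑ j, ∫ G, colProj k i j G * conjDiag b j i G * weight a b G ∂μ =
      b k * ∫ G, colProj k i i G * weight a b G ∂μ := by
    rw [← integral_finsetSum, ← integral_const_mul]
    · refine integral_congr_ae (Filter.Eventually.of_forall fun G => ?_)
      simp only
      rw [← Finset.sum_mul, sum_colProj_mul_conjDiag, mul_assoc]
    · intro j _
      exact Continuous.integrable_of_compactSpace (by fun_prop)
  rw [← h1, ← Finset.add_sum_erase _ _ (Finset.mem_univ i), eq_sub_iff_add_eq]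
  congr 1
  refine Finset.sum_congr rfl fun j hj => ?_
  have hij := (Finset.ne_of_mem_erase hj).symm
  rw [← sub_mul_integral_colProj_mul_conjDiag μ a b k hij,
    inv_mul_cancel_left₀ (sub_ne_zero.2 (ha.ne hij))]

theorem integral_weight_comp_perm (a b : Fin p → ℂ) (τ : Equiv.Perm (Fin p)) :
    ∫ G, weight (a ∘ τ) b G ∂μ = ∫ G, weight a b G ∂μ := by
  rw [← integral_mul_left_eq_self (μ := μ) (weight a b) (permutation τ⁻¹)]
  refine integral_congr_ae (Filter.Eventually.of_forall fun G => ?_)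
  simp only [weight, conjDiag, permutation_mul_apply]
  congr 1
  exact Fintype.sum_equiv τ _ _ fun i => by simp

end Integral

end Matrix.unitaryGroup

section VandermondeProduct

variable {p : ℕ}

/-- The product of all the differences `v j - v i` with `i < j`. -/
def vandermondeProd (v : Fin p → ℂ) : ℂ :=
  ∏ j : Fin p, ∏ i ∈ Finset.univ.filter (· < j), (v j - v i)

theorem vandermondeProd_eq_det (v : Fin p → ℂ) : vandermondeProd v = (vandermonde v).det := by
  rw [det_vandermonde, vandermondeProd]
  exact Finset.prod_comm' (by simp)

theorem vandermondeProd_ne_zero {v : Fin p → ℂ} (hv : Function.Injective v) :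
    vandermondeProd v ≠ 0 := by
  rw [vandermondeProd_eq_det]
  exact det_vandermonde_ne_zero_iff.2 hv

theorem vandermondeProd_comp_perm (v : Fin p → ℂ) (τ : Equiv.Perm (Fin p)) :
    vandermondeProd (v ∘ τ) = (Equiv.Perm.sign τ : ℂ) * vandermondeProd v := by
  rw [vandermondeProd_eq_det, vandermondeProd_eq_det]
  exact det_permute τ (vandermonde v)

theorem vandermondeProd_smul (t : ℂ) (v : Fin p → ℂ) :
    vandermondeProd (fun i => t * v i) =
      (∏ j : Fin p, ∏ _i ∈ Finset.univ.filter (· < j), t) * vandermondeProd v := by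
  simp only [vandermondeProd, ← mul_sub, Finset.prod_mul_distrib]

theorem vandermondeProd_natCast (p : ℕ) :
    vandermondeProd (fun i : Fin p => (i : ℂ)) =
      ∏ j ∈ Finset.range (p - 1), (Nat.factorial (j + 1) : ℂ) := by
  cases p with
  | zero => simp [vandermondeProd]
  | succ n =>
    rw [vandermondeProd_eq_det, det_vandermonde_id_eq_superFactorial]
    simp only [Nat.add_sub_cancel]
    induction n with
    | zero => simp
    | succ n ih => rw [Finset.prod_range_succ, ← ih, Nat.superFactorial_succ]; push_cast; ring

theorem contDiff_vandermondeProd {n : WithTop ℕ∞} :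
    ContDiff ℂ n (vandermondeProd : (Fin p → ℂ) → ℂ) := by
  unfold vandermondeProd
  exact contDiff_prod fun j _ => contDiff_prod fun i _ => by fun_prop

theorem HasFDerivAt.prod_of_eq_smul {κ 𝕜 E : Type*} [NontriviallyNormedField 𝕜]
    [NormedAddCommGroup E] [NormedSpace 𝕜 E] {s : Finset κ} {f : κ → E → 𝕜} {L : κ → E →L[𝕜] 𝕜}
    {e : E} (h : ∀ k ∈ s, HasFDerivAt (f k) (f k e • L k) e) :
    HasFDerivAt (fun e => ∏ k ∈ s, f k e) ((∏ k ∈ s, f k e) • ∑ k ∈ s, L k) e := by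
  classical
  refine (HasFDerivAt.finsetProd h).congr_fderiv ?_
  rw [Finset.smul_sum]
  refine Finset.sum_congr rfl fun k hk => ?_
  rw [smul_smul, Finset.prod_erase_mul _ _ hk]

theorem fderiv_vandermondeProd {v : Fin p → ℂ} (hv : Function.Injective v) (i : Fin p) :
    fderiv ℂ vandermondeProd v (Pi.single i 1) =
      vandermondeProd v * ∑ j ∈ Finset.univ.erase i, (v i - v j)⁻¹ := by
  have h : HasFDerivAt vandermondeProd (vandermondeProd v • ∑ j : Fin p,
      ∑ l ∈ Finset.univ.filter (· < j), (v j - v l)⁻¹ •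
        (ContinuousLinearMap.proj (R := ℂ) (φ := fun _ : Fin p => ℂ) j -
          ContinuousLinearMap.proj (R := ℂ) (φ := fun _ : Fin p => ℂ) l)) v := by
    refine HasFDerivAt.prod_of_eq_smul fun j _ => HasFDerivAt.prod_of_eq_smul fun l hl => ?_
    rw [smul_inv_smul₀ (sub_ne_zero.2 (hv.ne (Finset.mem_filter.1 hl).2.ne'))]
    exact ContinuousLinearMap.hasFDerivAt
      (ContinuousLinearMap.proj (R := ℂ) (φ := fun _ : Fin p => ℂ) j -
        ContinuousLinearMap.proj (R := ℂ) (φ := fun _ : Fin p => ℂ) l)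
  rw [h.fderiv]
  simp only [_root_.smul_apply, _root_.sum_apply, smul_eq_mul,
    _root_.sub_apply, ContinuousLinearMap.proj_apply]
  congr 1
  have h1 : ∀ j l : Fin p, (v j - v l)⁻¹ * ((Pi.single i 1 : Fin p → ℂ) j -
      (Pi.single i 1 : Fin p → ℂ) l) = (if j = i then (v i - v l)⁻¹ else 0) +
        if l = i then (v i - v j)⁻¹ else 0 := by
    intro j l
    by_cases hj : j = i <;> by_cases hl : l = i
    · subst hj; subst hl; simp
    · subst hj; simp [hl]
    · subst hl
      simp only [Pi.single_eq_same, Pi.single_eq_of_ne hj, if_neg hj, if_true]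
      rw [← neg_sub (v l) (v j), inv_neg]
      ring
    · simp [hj, hl]
  have h2 : ∀ j, ∑ l ∈ Finset.univ.filter (· < j), (if j = i then (v i - v l)⁻¹ else 0) =
      if j = i then ∑ l ∈ Finset.univ.filter (· < i), (v i - v l)⁻¹ else 0 := by
    intro j
    by_cases hj : j = i
    · subst hj; simp
    · simp [hj]
  have h3 : ∀ j, ∑ l ∈ Finset.univ.filter (· < j), (if l = i then (v i - v j)⁻¹ else 0) =
      if i < j then (v i - v j)⁻¹ else 0 := by
    intro j
    rw [Finset.sum_ite_eq']
    simp
  simp only [h1, Finset.sum_add_distrib, h2, h3]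
  rw [Finset.sum_ite_eq', if_pos (Finset.mem_univ i), Finset.sum_filter, ← Finset.sum_add_distrib,
    ← Finset.sum_erase Finset.univ (a := i) (by simp)]
  refine Finset.sum_congr rfl fun j hj => ?_
  rcases lt_or_gt_of_ne (Finset.ne_of_mem_erase hj) with h | h
  · simp [h, h.not_gt]
  · simp [h, h.not_gt]

end VandermondeProduct

namespace Matrix.unitaryGroup

section Formula

variable {p : ℕ} (μ : Measure (unitaryGroup (Fin p) ℂ))

theorem contDiff_integral_mul_weight [IsFiniteMeasure μ] (b : Fin p → ℂ)
    {h : unitaryGroup (Fin p) ℂ → ℂ} (hh : Continuous h) :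
    ContDiff ℂ (⊤ : ℕ∞) fun a => ∫ G, h G * weight a b G ∂μ :=
  contDiff_integral_mul_exp (fun i => continuous_conjDiag b i i) hh

theorem contDiff_integral_weight [IsFiniteMeasure μ] (b : Fin p → ℂ) :
    ContDiff ℂ (⊤ : ℕ∞) fun a => ∫ G, weight a b G ∂μ := by
  simpa using contDiff_integral_mul_weight μ b (h := fun _ => 1) continuous_const

theorem fderiv_integral_mul_weight [IsFiniteMeasure μ] (a b : Fin p → ℂ)
    {h : unitaryGroup (Fin p) ℂ → ℂ} (hh : Continuous h) (i : Fin p) :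
    fderiv ℂ (fun a => ∫ G, h G * weight a b G ∂μ) a (Pi.single i 1) =
      ∫ G, h G * conjDiag b i i G * weight a b G ∂μ := by
  unfold weight
  rw [(hasFDerivAt_integral_mul_exp (fun i => continuous_conjDiag b i i) hh a).fderiv]
  simp [Pi.single_apply]

variable [μ.IsMulLeftInvariant]

theorem exists_eventually_vandermondeProd_mul_integral_eq [IsFiniteMeasure μ] {a₀ b : Fin p → ℂ}
    (ha₀ : Function.Injective a₀) (hb : Function.Injective b) :
    ∃ c : Equiv.Perm (Fin p) → ℂ, ∀ᶠ a in nhds a₀,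
      vandermondeProd a * ∫ G, weight a b G ∂μ = ∑ σ, c σ * exp (∑ i, b (σ i) * a i) := by
  have hopen : IsOpen {a : Fin p → ℂ | vandermondeProd a ≠ 0} :=
    isOpen_ne_fun (contDiff_vandermondeProd (n := 0)).continuous continuous_const
  obtain ⟨r, hr, hball⟩ := Metric.isOpen_iff.1 hopen a₀ (vandermondeProd_ne_zero ha₀)
  have hinj : ∀ a ∈ Metric.ball a₀ r, Function.Injective a := fun a ha => by
    have h := hball ha
    rw [Set.mem_ofPred_eq, vandermondeProd_eq_det] at h
    exact det_vandermonde_ne_zero_iff.1 h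
  obtain ⟨c, hc⟩ := exists_eq_sum_perm_exp (U := Metric.ball a₀ r) Metric.isOpen_ball
    (convex_ball a₀ r).isPreconnected hinj b hb
    (fun a => vandermondeProd a * ∫ G, weight a b G ∂μ)
    (fun k i a => vandermondeProd a * ∫ G, colProj k i i G * weight a b G ∂μ)
    (contDiff_vandermondeProd.mul (contDiff_integral_weight μ b)).contDiffOn
    (fun k i => (contDiff_vandermondeProd.mul
      (contDiff_integral_mul_weight μ b (continuous_colProj k i i))).contDiffOn)
    (by
      intro k a _
      rw [← Finset.mul_sum, ← integral_finsetSum]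
      · simp only [← Finset.sum_mul, sum_colProj_self, one_mul]
      · intro i _
        exact ((continuous_colProj k i i).mul (continuous_weight a b)).integrable_of_compactSpace)
    (by
      intro k i a ha
      rw [fderiv_fun_mul (contDiff_vandermondeProd (n := 1)).differentiable_one.differentiableAt
        ((contDiff_integral_mul_weight μ b (continuous_colProj k i i)).differentiable
          (by simp)).differentiableAt]
      simp only [_root_.add_apply, _root_.smul_apply, smul_eq_mul]
      rw [fderiv_integral_mul_weight μ a b (continuous_colProj k i i),
        fderiv_vandermondeProd (hinj a ha), integral_colProj_self_mul_conjDiag μ a b (hinj a ha)]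
      simp only [mul_sub, Finset.sum_sub_distrib, ← Finset.sum_mul, Finset.mul_sum,
        mul_left_comm _ (vandermondeProd a)]
      simp only [← Finset.mul_sum]
      ring)
  exact ⟨c, Filter.eventually_of_mem (Metric.ball_mem_nhds a₀ hr) hc⟩

theorem exists_vandermondeProd_mul_integral_eq [IsFiniteMeasure μ] {b : Fin p → ℂ}
    (hb : Function.Injective b) :
    ∃ c : Equiv.Perm (Fin p) → ℂ, ∀ a,
      vandermondeProd a * ∫ G, weight a b G ∂μ = ∑ σ, c σ * exp (∑ i, b (σ i) * a i) := by
  obtain ⟨c, hc⟩ := exists_eventually_vandermondeProd_mul_integral_eq μ hb hb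
  refine ⟨c, fun a => ?_⟩
  have hline : Differentiable ℂ fun t : ℂ => b + t • (a - b) := by fun_prop
  have hl : Differentiable ℂ fun t : ℂ => vandermondeProd (b + t • (a - b)) *
      ∫ G, weight (b + t • (a - b)) b G ∂μ :=
    ((contDiff_vandermondeProd (n := 1)).differentiable_one.mul
      ((contDiff_integral_weight μ b).differentiable (by simp))).comp hline
  have hr : Differentiable ℂ fun t : ℂ =>
      ∑ σ, c σ * exp (∑ i, b (σ i) * (b + t • (a - b)) i) := by
    simp only [Pi.add_apply, Pi.smul_apply]
    fun_prop
  have hcont : Filter.Tendsto (fun t : ℂ => b + t • (a - b)) (nhds 0) (nhds b) := by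
    simpa using hline.continuous.tendsto 0
  have h := AnalyticOnNhd.eq_of_eventuallyEq
    (Complex.analyticOnNhd_univ_iff_differentiable.2 hl)
    (Complex.analyticOnNhd_univ_iff_differentiable.2 hr) (hcont.eventually hc)
  simpa using congrFun h 1

theorem exists_vandermondeProd_mul_integral_eq_det [IsFiniteMeasure μ] {b : Fin p → ℂ}
    (hb : Function.Injective b) :
    ∃ c : ℂ, ∀ a, vandermondeProd a * ∫ G, weight a b G ∂μ =
      c * det (of fun i j : Fin p => exp (a i * b j)) := by
  obtain ⟨c, hc⟩ := exists_vandermondeProd_mul_integral_eq μ hb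
  have hfac : (Nat.factorial p : ℂ) ≠ 0 := Nat.cast_ne_zero.2 (Nat.factorial_ne_zero p)
  refine ⟨(Nat.factorial p : ℂ)⁻¹ * ∑ σ, c σ * (Equiv.Perm.sign σ : ℂ), fun a => ?_⟩
  have hsign : ∀ τ : Equiv.Perm (Fin p),
      ((Equiv.Perm.sign τ : ℤ) : ℂ) * ((Equiv.Perm.sign τ : ℤ) : ℂ) = 1 := by
    intro τ
    rw [← Int.cast_mul, ← Units.val_mul, Int.units_mul_self]
    simp
  have h1 : ∀ τ : Equiv.Perm (Fin p), vandermondeProd a * ∫ G, weight a b G ∂μ =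
      (Equiv.Perm.sign τ : ℂ) * ∑ σ, c σ * exp (∑ i, b (σ i) * a (τ i)) := by
    intro τ
    have h := hc (a ∘ τ)
    rw [vandermondeProd_comp_perm, integral_weight_comp_perm] at h
    simp only [Function.comp_apply] at h
    rw [← h, ← mul_assoc, ← mul_assoc, hsign, one_mul]
  have h2 : ∀ σ : Equiv.Perm (Fin p),
      ∑ τ : Equiv.Perm (Fin p), (Equiv.Perm.sign τ : ℂ) * exp (∑ i, b (σ i) * a (τ i)) =
        (Equiv.Perm.sign σ : ℂ) * det (of fun i j : Fin p => exp (a i * b j)) := by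
    intro σ
    rw [← det_permute', det_apply']
    refine Finset.sum_congr rfl fun τ _ => ?_
    rw [Complex.exp_sum]
    congr 1
    exact Finset.prod_congr rfl fun i _ => by simp [mul_comm]
  have h3 : (Nat.factorial p : ℂ) * (vandermondeProd a * ∫ G, weight a b G ∂μ) =
      (∑ σ, c σ * (Equiv.Perm.sign σ : ℂ)) * det (of fun i j : Fin p => exp (a i * b j)) := by
    have h4 : ∑ _τ : Equiv.Perm (Fin p), vandermondeProd a * ∫ G, weight a b G ∂μ =
        (Nat.factorial p : ℂ) * (vandermondeProd a * ∫ G, weight a b G ∂μ) := by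
      rw [Finset.sum_const, Finset.card_univ, Fintype.card_perm, Fintype.card_fin, nsmul_eq_mul]
    rw [← h4, Finset.sum_congr rfl fun τ _ => h1 τ]
    simp only [Finset.mul_sum]
    rw [Finset.sum_comm, Finset.sum_mul]
    refine Finset.sum_congr rfl fun σ _ => ?_
    rw [mul_assoc, ← h2, Finset.mul_sum]
    exact Finset.sum_congr rfl fun τ _ => by ring
  rw [mul_assoc, ← h3, inv_mul_cancel_left₀ hfac]

theorem vandermondeProd_mul_vandermondeProd_mul_integral [IsProbabilityMeasure μ]
    {b : Fin p → ℂ} (hb : Function.Injective b) (a : Fin p → ℂ) :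
    vandermondeProd a * vandermondeProd b * ∫ G, weight a b G ∂μ =
      (∏ j ∈ Finset.range (p - 1), (Nat.factorial (j + 1) : ℂ)) *
        det (of fun i j : Fin p => exp (a i * b j)) := by
  obtain ⟨c, hc⟩ := exists_vandermondeProd_mul_integral_eq_det μ hb
  suffices h : vandermondeProd (fun i : Fin p => (i : ℂ)) = c * vandermondeProd b by
    rw [← vandermondeProd_natCast, h]
    linear_combination vandermondeProd b * hc a
  have hF : Filter.Tendsto (fun t : ℂ => vandermondeProd (fun i : Fin p => (i : ℂ)) *
      ∫ G, weight (fun i => t * (i : ℂ)) b G ∂μ) (nhdsWithin 0 {0}ᶜ)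
      (nhds (vandermondeProd (fun i : Fin p => (i : ℂ)))) := by
    have h1 : Continuous fun t : ℂ => ∫ G, weight (fun i : Fin p => t * (i : ℂ)) b G ∂μ :=
      (contDiff_integral_weight μ b).continuous.comp (by fun_prop)
    have h2 := (h1.tendsto 0).const_mul (vandermondeProd (fun i : Fin p => (i : ℂ)))
    have h3 : ∫ G, weight (fun i : Fin p => 0 * (i : ℂ)) b G ∂μ = 1 := by simp [weight]
    rw [h3, mul_one] at h2
    exact h2.mono_left nhdsWithin_le_nhds
  have hV : Filter.Tendsto (fun t : ℂ => c * ∏ j : Fin p, ∏ i ∈ Finset.univ.filter (· < j),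
      t⁻¹ * (exp (t * b j) - exp (t * b i))) (nhdsWithin 0 {0}ᶜ)
      (nhds (c * vandermondeProd b)) := by
    refine Filter.Tendsto.const_mul c (tendsto_finsetProd _ fun j _ =>
      tendsto_finsetProd _ fun i _ => ?_)
    have hd : HasDerivAt (fun t : ℂ => exp (t * b j) - exp (t * b i)) (b j - b i) 0 := by
      refine (((hasDerivAt_id (0 : ℂ)).mul_const (b j)).cexp.sub
        ((hasDerivAt_id (0 : ℂ)).mul_const (b i)).cexp).congr_deriv ?_
      simp
    simpa using hd.tendsto_slope_zero
  refine tendsto_nhds_unique hF (hV.congr' ?_)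
  filter_upwards [self_mem_nhdsWithin] with t ht
  have h1 := hc fun i : Fin p => t * (i : ℂ)
  have h2 : det (of fun i j : Fin p => exp (t * (i : ℂ) * b j)) =
      vandermondeProd fun j => exp (t * b j) := by
    rw [vandermondeProd_eq_det, ← det_transpose]
    congr 1
    ext i j
    simp only [transpose_apply, of_apply, vandermonde_apply, ← Complex.exp_nat_mul]
    congr 1
    ring
  have h3 : ∏ j : Fin p, ∏ _i ∈ Finset.univ.filter (· < j), t ≠ 0 :=
    Finset.prod_ne_zero_iff.2 fun j _ => Finset.prod_ne_zero_iff.2 fun i _ => ht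
  rw [h2, vandermondeProd_smul] at h1
  simp only [Finset.prod_mul_distrib, Finset.prod_inv_distrib]
  refine mul_left_cancel₀ h3 ?_
  rw [← mul_assoc _ (vandermondeProd _), h1, mul_left_comm, mul_inv_cancel_left₀ h3]
  rfl

end Formula

end Matrix.unitaryGroup

/-- The Harish-Chandra/Itzykson–Zuber determinantal formula: for diagonal matrices
`A = diag(a₁,…,a_p)` and `B = diag(b₁,…,b_p)` with pairwise distinct diagonal entries,
`∫_{U(p)} exp(tr(A G B G⁻¹)) dG
  = (∏_{j=1}^{p−1} j!) det_{1≤i,j≤p}(e^{aᵢbⱼ}) / (∏_{i<j}(a_j−a_i) ∏_{i<j}(b_j−b_i))`,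
`dG` denoting the Haar probability measure on `U(p)`. -/
theorem harish_chandra_itzykson_zuber (p : ℕ) (hp : 1 ≤ p) (a b : Fin p → ℂ)
    (ha : ∀ i j : Fin p, i ≠ j → a i ≠ a j)
    (hb : ∀ i j : Fin p, i ≠ j → b i ≠ b j)
    (μ : Measure (Matrix.unitaryGroup (Fin p) ℂ))
    [μ.IsMulLeftInvariant] [IsProbabilityMeasure μ] :
    ∫ G : Matrix.unitaryGroup (Fin p) ℂ,
        Complex.exp (Matrix.trace
          (Matrix.diagonal a * (G : Matrix (Fin p) (Fin p) ℂ) * Matrix.diagonal b *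
            ((G⁻¹ : Matrix.unitaryGroup (Fin p) ℂ) : Matrix (Fin p) (Fin p) ℂ))) ∂μ
      = (∏ j ∈ Finset.range (p - 1), (Nat.factorial (j + 1) : ℂ)) *
          Matrix.det (Matrix.of fun i j : Fin p => Complex.exp (a i * b j)) /
          ((∏ j : Fin p, ∏ i ∈ Finset.univ.filter (· < j), (a j - a i)) *
            ∏ j : Fin p, ∏ i ∈ Finset.univ.filter (· < j), (b j - b i)) := by
  have ha' : Function.Injective a := fun i j h => by_contra fun hij => ha i j hij h
  have hb' : Function.Injective b := fun i j h => by_contra fun hij => hb i j hij h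
  have key := unitaryGroup.vandermondeProd_mul_vandermondeProd_mul_integral μ hb' a
  simp only [unitaryGroup.trace_diagonal_mul_conj]
  change ∫ G, unitaryGroup.weight a b G ∂μ = _ / (vandermondeProd a * vandermondeProd b)
  rw [eq_div_iff (mul_ne_zero (vandermondeProd_ne_zero ha') (vandermondeProd_ne_zero hb')), ← key,
    mul_comm]
end

section
/- Let c > 0 and 0 < h < √c, and set z₀ = (1+h)(c+h)/h, a_c = (1−√c)², b_c = (1+√c)². Then max(0, 1−1/c)·ln z₀ + ∫_{a_c}^{b_c} ln(z₀−x) · √((b_c−x)(x−a_c))/(2πcx) dx = h/c − ((1−c)/c)·ln(1+h) + ln(c/h). Equivalently, with f(z) = −( h z/(1+h) − c ∫ ln(z−λ) dF_c(λ) ), one has f(z₀) = −c − (1−c)·ln(1+h) + c·ln(c/h). -/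
open Real intervalIntegral

lemma one_sub_two_mul_mul_cos_add_sq_pos {r : ℝ} (hr : |r| < 1) (θ : ℝ) :
    0 < 1 - 2 * r * cos θ + r ^ 2 := by
  have h : |r * cos θ| < 1 := by
    rw [abs_mul]
    exact (mul_le_of_le_one_right (abs_nonneg r) (abs_cos_le_one θ)).trans_lt hr
  nlinarith [sin_sq_add_cos_sq θ, sq_nonneg (r * sin θ), (abs_lt.1 h).2]

/-- Half-circle form of the Poisson integral formula for boundary data depending only on the
real part. -/
lemma integral_poissonKernel_mul_cos {F : ℂ → ℝ} {u : ℝ → ℝ}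
    (hF : InnerProductSpace.HarmonicOnNhd F (Metric.closedBall 0 1))
    (hu : ∀ θ : ℝ, F (circleMap 0 1 θ) = u (cos θ)) {p : ℝ} (hp : |p| < 1) :
    ∫ θ in 0..π, (1 - p ^ 2) / (1 - 2 * p * cos θ + p ^ 2) * u (cos θ) = π * F p := by
  have hden := one_sub_two_mul_mul_cos_add_sq_pos hp
  have hcont : Continuous fun θ : ℝ ↦
      (1 - p ^ 2) / (1 - 2 * p * cos θ + p ^ 2) * u (cos θ) := by
    refine (Continuous.div (by fun_prop) (by fun_prop) fun θ ↦ (hden θ).ne').mul ?_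
    simp only [← hu]
    exact hF.continuousOn.comp_continuous (continuous_circleMap 0 1) fun θ ↦ by simp
  have hfull : ∫ θ in 0..2 * π, (1 - p ^ 2) / (1 - 2 * p * cos θ + p ^ 2) * u (cos θ)
      = 2 * π * F p := by
    have h := hF.circleAverage_poissonKernel_smul (w := (p : ℂ)) (by simpa using hp)
    rw [circleAverage_def, smul_eq_mul, inv_mul_eq_iff_eq_mul₀ (by positivity)] at h
    rw [← h]
    refine integral_congr fun θ _ ↦ ?_
    have hnorm : ‖circleMap 0 1 θ - p‖ ^ 2 = 1 - 2 * p * cos θ + p ^ 2 := by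
      rw [← Complex.normSq_eq_norm_sq, Complex.normSq_apply]
      simp [circleMap, Complex.exp_re, Complex.exp_im]
      linear_combination sin_sq_add_cos_sq θ
    simp [poissonKernel_def, hnorm, hu]
  have hrefl : ∫ θ in π..2 * π, (1 - p ^ 2) / (1 - 2 * p * cos θ + p ^ 2) * u (cos θ)
      = ∫ θ in 0..π, (1 - p ^ 2) / (1 - 2 * p * cos θ + p ^ 2) * u (cos θ) := by
    have h := integral_comp_sub_left (a := 0) (b := π)
      (fun θ ↦ (1 - p ^ 2) / (1 - 2 * p * cos θ + p ^ 2) * u (cos θ)) (2 * π)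
    simp only [cos_two_pi_sub, sub_zero] at h
    rw [h]
    congr 1
    ring
  have hadd := integral_add_adjacent_intervals (hcont.intervalIntegrable 0 π)
    (hcont.intervalIntegrable π (2 * π)) (μ := MeasureTheory.volume)
  linarith

lemma integral_poissonKernel {p : ℝ} (hp : |p| < 1) :
    ∫ θ in 0..π, (1 - p ^ 2) / (1 - 2 * p * cos θ + p ^ 2) = π := by
  have h := integral_poissonKernel_mul_cos (F := fun _ ↦ 1) (u := fun _ ↦ 1)
    (fun z _ ↦ InnerProductSpace.harmonicAt_const 1) (fun _ ↦ rfl) hp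
  simpa using h

lemma integral_poissonKernel_mul_log {r p : ℝ} (hr : |r| < 1) (hp : |p| < 1) :
    ∫ θ in 0..π, (1 - p ^ 2) / (1 - 2 * p * cos θ + p ^ 2) * log (1 - 2 * r * cos θ + r ^ 2)
      = π * (2 * log (1 - r * p)) := by
  have hne {z : ℂ} (hz : ‖z‖ ≤ 1) : 1 - (r : ℂ) * z ≠ 0 := by
    intro h
    have h' : ‖(r : ℂ) * z‖ = 1 := by rw [← sub_eq_zero.1 h]; simp
    rw [norm_mul, Complex.norm_real, norm_eq_abs] at h'
    nlinarith [abs_nonneg r, norm_nonneg z]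
  have hF : InnerProductSpace.HarmonicOnNhd (fun z : ℂ ↦ 2 * log ‖1 - (r : ℂ) * z‖)
      (Metric.closedBall 0 1) := fun z hz ↦ by
    have h := AnalyticAt.harmonicAt_log_norm (f := fun z : ℂ ↦ 1 - (r : ℂ) * z) (z := z)
      (by fun_prop) (hne (by simpa using hz))
    exact h.const_smul (c := (2 : ℝ))
  have hu (θ : ℝ) : 2 * log ‖1 - (r : ℂ) * circleMap 0 1 θ‖
      = log (1 - 2 * r * cos θ + r ^ 2) := by
    have hnorm : ‖1 - (r : ℂ) * circleMap 0 1 θ‖ ^ 2 = 1 - 2 * r * cos θ + r ^ 2 := by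
      rw [← Complex.normSq_eq_norm_sq, Complex.normSq_apply]
      simp [circleMap, Complex.exp_re, Complex.exp_im]
      linear_combination r ^ 2 * sin_sq_add_cos_sq θ
    rw [← hnorm, log_pow]
    norm_num
  rw [integral_poissonKernel_mul_cos (u := fun t ↦ log (1 - 2 * r * t + r ^ 2)) hF hu hp]
  have hcast : (1 : ℂ) - r * p = ((1 - r * p : ℝ) : ℂ) := by push_cast; ring
  simp only [hcast, Complex.norm_real, norm_eq_abs, log_abs]

lemma sin_sq_div_add_two_mul_cos {s θ : ℝ} (hs : s ≠ 0) (hd : 1 + s ^ 2 + 2 * s * cos θ ≠ 0) :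
    sin θ ^ 2 / (1 + s ^ 2 + 2 * s * cos θ) = (1 + s ^ 2) / (4 * s ^ 2) - cos θ / (2 * s)
      - 1 / (4 * s ^ 2) * ((1 - s ^ 2) ^ 2 / (1 + s ^ 2 + 2 * s * cos θ)) := by
  rw [div_eq_iff hd, sub_mul, mul_assoc (1 / (4 * s ^ 2)), div_mul_cancel₀ _ hd, sin_sq]
  field_simp
  ring

lemma integral_cos_mul_log {r : ℝ} (hr0 : r ≠ 0) (hr : |r| < 1) :
    ∫ θ in 0..π, cos θ * log (1 - 2 * r * cos θ + r ^ 2) = -(π * r) := by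
  have hpos := one_sub_two_mul_mul_cos_add_sq_pos hr
  have hcont : Continuous fun θ ↦ (1 - r ^ 2) / (1 - 2 * r * cos θ + r ^ 2) :=
    Continuous.div (by fun_prop) (by fun_prop) fun θ ↦ (hpos θ).ne'
  have hderiv (θ : ℝ) : HasDerivAt (fun θ ↦ 1 - 2 * r * cos θ + r ^ 2) (2 * r * sin θ) θ := by
    simpa using (((hasDerivAt_cos θ).const_mul (2 * r)).const_sub 1).add_const (r ^ 2)
  have hparts := integral_deriv_mul_eq_sub (a := 0) (b := π)
    (u := sin) (u' := cos) (v := fun θ ↦ log (1 - 2 * r * cos θ + r ^ 2))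
    (v' := fun θ ↦ 2 * r * sin θ / (1 - 2 * r * cos θ + r ^ 2))
    (fun θ _ ↦ hasDerivAt_sin θ)
    (fun θ _ ↦ (hderiv θ).log (hpos θ).ne')
    (continuous_cos.intervalIntegrable _ _)
    ((Continuous.div (by fun_prop) (by fun_prop) fun θ ↦ (hpos θ).ne').intervalIntegrable _ _)
  have hlog : Continuous fun θ ↦ cos θ * log (1 - 2 * r * cos θ + r ^ 2) :=
    continuous_cos.mul (Continuous.log (by fun_prop) fun θ ↦ (hpos θ).ne')
  have hpt (θ : ℝ) : cos θ * log (1 - 2 * r * cos θ + r ^ 2)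
        + sin θ * (2 * r * sin θ / (1 - 2 * r * cos θ + r ^ 2))
      = cos θ * log (1 - 2 * r * cos θ + r ^ 2) + ((1 + r ^ 2) / (2 * r) + cos θ
        - (1 - r ^ 2) / (2 * r) * ((1 - r ^ 2) / (1 - 2 * r * cos θ + r ^ 2))) := by
    have hden : 1 + (-r) ^ 2 + 2 * -r * cos θ = 1 - 2 * r * cos θ + r ^ 2 := by ring
    have h := sin_sq_div_add_two_mul_cos (neg_ne_zero.2 hr0) (hden ▸ (hpos θ).ne')
    rw [hden] at h
    have hsplit : sin θ * (2 * r * sin θ / (1 - 2 * r * cos θ + r ^ 2))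
        = 2 * r * (sin θ ^ 2 / (1 - 2 * r * cos θ + r ^ 2)) := by ring
    rw [hsplit, h]
    field_simp
    ring
  simp only [hpt] at hparts
  rw [integral_add (hlog.intervalIntegrable _ _)
      (Continuous.intervalIntegrable (by fun_prop) _ _),
    integral_sub (Continuous.intervalIntegrable (by fun_prop) _ _)
      (Continuous.intervalIntegrable (by fun_prop) _ _),
    integral_add (by simp) (Continuous.intervalIntegrable (by fun_prop) _ _),
    integral_const_mul, integral_poissonKernel hr] at hparts
  generalize ∫ θ in 0..π, cos θ * log (1 - 2 * r * cos θ + r ^ 2) = J at hparts ⊢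
  simp at hparts
  field_simp at hparts
  have h : 2 * r * (J + π * r) = 0 := by linear_combination hparts
  rcases mul_eq_zero.1 h with h | h
  · exact absurd h (by positivity)
  · linarith

lemma exists_poissonKernel_eq {s : ℝ} (hs : 0 < s) :
    ∃ p : ℝ, |p| < 1 ∧ (s < 1 → p = -s) ∧ (1 < s → p = -s⁻¹) ∧ ∀ θ : ℝ,
      (1 - s ^ 2) ^ 2 / (1 + s ^ 2 + 2 * s * cos θ)
        = |1 - s ^ 2| * ((1 - p ^ 2) / (1 - 2 * p * cos θ + p ^ 2)) := by
  rcases lt_trichotomy s 1 with h | rfl | h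
  · refine ⟨-s, by rwa [abs_neg, abs_of_pos hs], fun _ ↦ rfl, fun h' ↦ by linarith, fun θ ↦ ?_⟩
    rw [abs_of_nonneg (by nlinarith), ← mul_div_assoc]
    congr 1 <;> ring
  · exact ⟨0, by simp, fun h ↦ by simp at h, fun h ↦ by simp at h, fun θ ↦ by simp⟩
  · refine ⟨-s⁻¹, ?_, fun h' ↦ by linarith, fun _ ↦ rfl, fun θ ↦ ?_⟩
    · rw [abs_neg, abs_of_pos (inv_pos.2 hs)]
      exact inv_lt_one_of_one_lt₀ h
    · have hden : 1 - 2 * -s⁻¹ * cos θ + (-s⁻¹) ^ 2 = (1 + s ^ 2 + 2 * s * cos θ) / s ^ 2 := by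
        field_simp
        ring
      have hnum : 1 - (-s⁻¹) ^ 2 = (s ^ 2 - 1) / s ^ 2 := by
        field_simp
      rw [abs_of_nonpos (by nlinarith), hden, hnum, div_div_div_cancel_right₀ (by positivity),
        ← mul_div_assoc]
      congr 1
      ring

/-- The substitution `x = 1 + s² + 2 s cos θ` onto the Marchenko–Pastur support. -/
lemma integral_marchenkoPastur_eq_integral_cos {s : ℝ} (hs : 0 < s) (g : ℝ → ℝ) :
    ∫ x in (1 - s) ^ 2..(1 + s) ^ 2,
        g x * (√(((1 + s) ^ 2 - x) * (x - (1 - s) ^ 2)) / (2 * π * s ^ 2 * x))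
      = ∫ θ in 0..π, 2 / π * (g (1 + s ^ 2 + 2 * s * cos θ)
          * (sin θ ^ 2 / (1 + s ^ 2 + 2 * s * cos θ))) := by
  have himage : (fun θ ↦ 2 * s * cos θ + (1 + s ^ 2)) '' Set.Icc 0 π
      = Set.Icc ((1 - s) ^ 2) ((1 + s) ^ 2) := by
    rw [← Set.image_image (fun t ↦ 2 * s * t + (1 + s ^ 2)) cos, bijOn_cos.image_eq,
      Set.image_affine_Icc' (by positivity)]
    congr 1 <;> ring
  have hderiv (θ : ℝ) : HasDerivWithinAt (fun θ ↦ 2 * s * cos θ + (1 + s ^ 2))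
      (2 * s * -sin θ) (Set.Icc 0 π) θ :=
    (((hasDerivAt_cos θ).const_mul (2 * s)).add_const _).hasDerivWithinAt
  have hanti : AntitoneOn (fun θ ↦ 2 * s * cos θ + (1 + s ^ 2)) (Set.Icc 0 π) :=
    fun a ha b hb hab ↦ by
      have := strictAntiOn_cos.antitoneOn ha hb hab
      dsimp only
      gcongr
  rw [integral_of_le (by nlinarith), ← MeasureTheory.integral_Icc_eq_integral_Ioc, ← himage,
    MeasureTheory.integral_image_eq_integral_deriv_smul_of_antitoneOn measurableSet_Icc
      (fun θ _ ↦ hderiv θ) hanti,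
    MeasureTheory.integral_Icc_eq_integral_Ioc, ← integral_of_le pi_pos.le]
  refine integral_congr fun θ hθ ↦ ?_
  rw [Set.uIcc_of_le pi_pos.le] at hθ
  have hsin := sin_nonneg_of_mem_Icc hθ
  have hsqrt : √(((1 + s) ^ 2 - (2 * s * cos θ + (1 + s ^ 2)))
      * (2 * s * cos θ + (1 + s ^ 2) - (1 - s) ^ 2)) = 2 * s * sin θ := by
    rw [← sqrt_sq (show 0 ≤ 2 * s * sin θ by positivity)]
    congr 1
    linear_combination -4 * s ^ 2 * sin_sq_add_cos_sq θ
  simp only [hsqrt, smul_eq_mul]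
  rw [add_comm (2 * s * cos θ)]
  field_simp

lemma integral_sin_sq_div_mul_log {s r l : ℝ} (hs : 0 < s) (hr0 : 0 < r) (hr : r < 1) :
    ∫ θ in 0..π, 2 / π * ((l + log (1 - 2 * r * cos θ + r ^ 2))
        * (sin θ ^ 2 / (1 + s ^ 2 + 2 * s * cos θ)))
      = (1 + s ^ 2 - |1 - s ^ 2|) / (2 * s ^ 2) * l + r / s
        - |1 - s ^ 2| / s ^ 2 * log (1 + r * min s s⁻¹) := by
  obtain ⟨p, hp, hp₁, hp₂, hker⟩ := exists_poissonKernel_eq hs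
  have hr' : |r| < 1 := by rwa [abs_of_pos hr0]
  have hrp : |1 - s ^ 2| * log (1 + r * min s s⁻¹) = |1 - s ^ 2| * log (1 - r * p) := by
    rcases lt_trichotomy s 1 with h | rfl | h
    · rw [hp₁ h, min_eq_left (h.le.trans (one_le_inv₀ hs |>.2 h.le))]
      ring_nf
    · simp
    · rw [hp₂ h, min_eq_right ((inv_le_one_of_one_le₀ h.le).trans h.le)]
      ring_nf
  have hcontL : Continuous fun θ ↦ log (1 - 2 * r * cos θ + r ^ 2) :=
    Continuous.log (by fun_prop) fun θ ↦ (one_sub_two_mul_mul_cos_add_sq_pos hr' θ).ne'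
  have hcontP : Continuous fun θ ↦ (1 - p ^ 2) / (1 - 2 * p * cos θ + p ^ 2) :=
    Continuous.div (by fun_prop) (by fun_prop)
      fun θ ↦ (one_sub_two_mul_mul_cos_add_sq_pos hp θ).ne'
  have hconst : ∫ θ in 0..π, (l + log (1 - 2 * r * cos θ + r ^ 2)) = π * l := by
    have h := integral_poissonKernel_mul_log hr' (p := 0) (by simp)
    simp at h
    rw [integral_add (by simp) (hcontL.intervalIntegrable _ _), h]
    simp
  have hcos : ∫ θ in 0..π, cos θ * (l + log (1 - 2 * r * cos θ + r ^ 2)) = -(π * r) := by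
    simp only [mul_add]
    rw [integral_add (Continuous.intervalIntegrable (by fun_prop) _ _)
      (Continuous.intervalIntegrable (by fun_prop) _ _), integral_cos_mul_log hr0.ne' hr']
    simp
  have hpoisson : ∫ θ in 0..π, (1 - p ^ 2) / (1 - 2 * p * cos θ + p ^ 2)
      * (l + log (1 - 2 * r * cos θ + r ^ 2)) = π * l + π * (2 * log (1 - r * p)) := by
    simp only [mul_add]
    rw [integral_add (Continuous.intervalIntegrable (by fun_prop) _ _)
      (Continuous.intervalIntegrable (by fun_prop) _ _), integral_mul_const,
      integral_poissonKernel hp, integral_poissonKernel_mul_log hr' hp]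
  have hpt : ∀ θ ∈ Set.Ioo 0 π, 2 / π * ((l + log (1 - 2 * r * cos θ + r ^ 2))
        * (sin θ ^ 2 / (1 + s ^ 2 + 2 * s * cos θ)))
      = (1 + s ^ 2) / (2 * π * s ^ 2) * (l + log (1 - 2 * r * cos θ + r ^ 2))
        - 1 / (π * s) * (cos θ * (l + log (1 - 2 * r * cos θ + r ^ 2)))
        - |1 - s ^ 2| / (2 * π * s ^ 2) * ((1 - p ^ 2) / (1 - 2 * p * cos θ + p ^ 2)
          * (l + log (1 - 2 * r * cos θ + r ^ 2))) := fun θ hθ ↦ by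
    have hd : 0 < 1 + s ^ 2 + 2 * s * cos θ := by
      have hsin := sin_pos_of_mem_Ioo hθ
      have : 1 + s ^ 2 + 2 * s * cos θ = (s + cos θ) ^ 2 + sin θ ^ 2 := by
        linear_combination -sin_sq_add_cos_sq θ
      rw [this]
      positivity
    rw [sin_sq_div_add_two_mul_cos hs.ne' hd.ne', hker]
    generalize (1 - p ^ 2) / (1 - 2 * p * cos θ + p ^ 2) = P
    field_simp
    ring
  rw [integral_of_le pi_pos.le, MeasureTheory.integral_Ioc_eq_integral_Ioo,
    MeasureTheory.setIntegral_congr_fun measurableSet_Ioo hpt,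
    ← MeasureTheory.integral_Ioc_eq_integral_Ioo, ← integral_of_le pi_pos.le,
    integral_sub (Continuous.intervalIntegrable (by fun_prop) _ _)
      (Continuous.intervalIntegrable (by fun_prop) _ _),
    integral_sub (Continuous.intervalIntegrable (by fun_prop) _ _)
      (Continuous.intervalIntegrable (by fun_prop) _ _),
    integral_const_mul, integral_const_mul, integral_const_mul, hconst, hcos, hpoisson,
    div_mul_eq_mul_div |1 - s ^ 2| (s ^ 2), hrp]
  have := pi_pos.ne'
  field_simp
  ring

/-- Value of the Laplace phase function at the saddle point: for `0 < h < √c` and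
`z₀ = (1+h)(c+h)/h`, the log-potential of the Marchenko–Pastur distribution `F_c` (atom of
mass `max(0, 1−1/c)` at `0` plus density `√((b_c−x)(x−a_c))/(2πcx)` on `[a_c, b_c]`)
satisfies `∫ ln(z₀−λ) dF_c(λ) = h/c − ((1−c)/c) ln(1+h) + ln(c/h)`. -/
theorem mp_log_potential_at_saddle (c h : ℝ) (hc : 0 < c) (hh0 : 0 < h)
    (hh : h < Real.sqrt c) :
    max 0 (1 - 1 / c) * Real.log ((1 + h) * (c + h) / h) +
        ∫ x in ((1 - Real.sqrt c) ^ 2)..((1 + Real.sqrt c) ^ 2),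
          Real.log ((1 + h) * (c + h) / h - x) *
            (Real.sqrt (((1 + Real.sqrt c) ^ 2 - x) * (x - (1 - Real.sqrt c) ^ 2)) /
              (2 * Real.pi * c * x))
      = h / c - ((1 - c) / c) * Real.log (1 + h) + Real.log (c / h) := by
  obtain ⟨s, hs, rfl⟩ : ∃ s : ℝ, 0 < s ∧ c = s ^ 2 :=
    ⟨√c, sqrt_pos.2 hc, (sq_sqrt hc.le).symm⟩
  rw [sqrt_sq hs.le] at hh ⊢
  have hr : h / s < 1 := (div_lt_one hs).2 hh
  have hlog (θ : ℝ) : log ((1 + h) * (s ^ 2 + h) / h - (1 + s ^ 2 + 2 * s * cos θ))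
      = log (s ^ 2 / h) + log (1 - 2 * (h / s) * cos θ + (h / s) ^ 2) := by
    have hpos := one_sub_two_mul_mul_cos_add_sq_pos (r := h / s)
      (by rwa [abs_of_pos (by positivity)]) θ
    rw [← log_mul (by positivity) hpos.ne']
    congr 1
    field_simp
    ring
  rw [integral_marchenkoPastur_eq_integral_cos hs
    (fun x ↦ log ((1 + h) * (s ^ 2 + h) / h - x))]
  simp only [hlog]
  rw [integral_sin_sq_div_mul_log hs (by positivity) hr]
  rcases le_total s 1 with h₁ | h₁
  · have hs₁ : s ^ 2 ≤ 1 := by nlinarith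
    have hmin : h / s * min s s⁻¹ = h := by
      rw [min_eq_left (h₁.trans (one_le_inv₀ hs |>.2 h₁))]
      field_simp
    rw [max_eq_left (sub_nonpos.2 (one_le_one_div hc hs₁)), hmin, abs_of_nonneg (by linarith)]
    field_simp
    ring
  · have hs₁ : 1 ≤ s ^ 2 := by nlinarith
    have hmin : h / s * min s s⁻¹ = h / s ^ 2 := by
      rw [min_eq_right ((inv_le_one_of_one_le₀ h₁).trans h₁)]
      field_simp
    have hz : log ((1 + h) * (s ^ 2 + h) / h)
        = log (1 + h) + (log (s ^ 2 / h) + log (1 + h / s ^ 2)) := by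
      rw [← log_mul (by positivity) (by positivity), ← log_mul (by positivity) (by positivity)]
      congr 1
      field_simp
    rw [max_eq_right (sub_nonneg.2 ((div_le_one hc).2 hs₁)), hmin, abs_of_nonpos (by linarith),
      hz]
    field_simp
    ring
end

section
/- Let c > 0 and 0 < h < √c, and set z₀ = (1+h)(c+h)/h, a_c = (1−√c)², b_c = (1+√c)². Then max(0, 1−1/c)·(1/z₀²) + ∫_{a_c}^{b_c} √((b_c−x)(x−a_c)) / (2πcx·(z₀−x)²) dx = h² / ( c (1+h)² (c−h²) ). Equivalently, with f(z) = −( h z/(1+h) − c ∫ ln(z−λ) dF_c(λ) ), the second-order Taylor coefficient of f at z₀ equals f''(z₀)/2 = −h² / ( 2(1+h)²(c−h²) ). -/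
open Real intervalIntegral

/-- The Möbius map sending `[m - r, m + r]` onto `[-1, 1]` with pole at `p`, composed with `arcsin`,
is up to scaling a primitive of `1 / (|p - x| √(r² - (x - m)²))`. -/
theorem hasDerivAt_arcsin_moebius {m r p d x : ℝ} (hr : 0 < r) (hd : 0 < d)
    (hd2 : d ^ 2 = (p - m) ^ 2 - r ^ 2) (hpx : p - x ≠ 0) (hx : 0 < r ^ 2 - (x - m) ^ 2) :
    HasDerivAt (fun y => arcsin (((p - m) * (y - m) - r ^ 2) / (r * (p - y))))
      (d / (|p - x| * √(r ^ 2 - (x - m) ^ 2))) x := by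
  set w : ℝ := ((p - m) * (x - m) - r ^ 2) / (r * (p - x)) with hw
  have habs : 0 < |p - x| := abs_pos.mpr hpx
  have hone : 1 - w ^ 2 = d ^ 2 * (r ^ 2 - (x - m) ^ 2) / (r * |p - x|) ^ 2 := by
    rw [hw, mul_pow, sq_abs, hd2]
    field_simp
    ring
  have hpos : 0 < 1 - w ^ 2 := by rw [hone]; positivity
  have hsqrt : √(1 - w ^ 2) = d * √(r ^ 2 - (x - m) ^ 2) / (r * |p - x|) := by
    rw [hone, sqrt_div (by positivity), sqrt_sq (by positivity), sqrt_mul (by positivity),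
      sqrt_sq hd.le]
  have hderiv : HasDerivAt (fun y => ((p - m) * (y - m) - r ^ 2) / (r * (p - y)))
      (d ^ 2 / (r * (p - x) ^ 2)) x := by
    have hnum : HasDerivAt (fun y => (p - m) * (y - m) - r ^ 2) ((p - m) * 1) x :=
      (((hasDerivAt_id x).sub_const m).const_mul (p - m)).sub_const (r ^ 2)
    have hden : HasDerivAt (fun y => r * (p - y)) (r * -1) x :=
      ((hasDerivAt_id x).const_sub p).const_mul r
    refine (hnum.div hden (mul_ne_zero hr.ne' hpx)).congr_deriv ?_
    rw [hd2]
    field_simp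
    ring
  have hw1 : w ≠ -1 := by rintro h; rw [h] at hpos; norm_num at hpos
  have hw2 : w ≠ 1 := by rintro h; rw [h] at hpos; norm_num at hpos
  refine ((hasDerivAt_arcsin hw1 hw2).comp x hderiv).congr_deriv ?_
  have hR : 0 < √(r ^ 2 - (x - m) ^ 2) := sqrt_pos.mpr hx
  rw [hsqrt, ← sq_abs (p - x)]
  field_simp

theorem hasDerivAt_sqrt_div_sub {m r z x : ℝ} (hzx : z - x ≠ 0) (hx : 0 < r ^ 2 - (x - m) ^ 2) :
    HasDerivAt (fun y => √(r ^ 2 - (y - m) ^ 2) / (z - y))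
      ((r ^ 2 - (x - m) * (z - m)) / (√(r ^ 2 - (x - m) ^ 2) * (z - x) ^ 2)) x := by
  have hR : 0 < √(r ^ 2 - (x - m) ^ 2) := sqrt_pos.mpr hx
  have hQ : HasDerivAt (fun y => r ^ 2 - (y - m) ^ 2) (-(2 * (x - m))) x := by
    have := (((hasDerivAt_id x).sub_const m).pow 2).const_sub (r ^ 2)
    simpa using this
  have hden : HasDerivAt (fun y => z - y) (-1) x := (hasDerivAt_id x).const_sub z
  refine ((hQ.sqrt hx.ne').div hden hzx).congr_deriv ?_
  have hsq := sq_sqrt hx.le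
  field_simp
  rw [hsq]
  ring

/-- The Marchenko–Pastur-type integral of `√(r² - (x - m)²) / (x (z - x)²)` over `[m - r, m + r]`,
for a pole `z` to the right of the interval. -/
theorem integral_sqrt_div_mul_sub_sq {m r z d e : ℝ} (hr : 0 < r) (hrm : r ≤ m) (hz : m + r < z)
    (hd : 0 < d) (hd2 : d ^ 2 = (z - m) ^ 2 - r ^ 2) (he : 0 ≤ e) (he2 : e ^ 2 = m ^ 2 - r ^ 2) :
    ∫ x in (m - r)..(m + r), √(r ^ 2 - (x - m) ^ 2) / (x * (z - x) ^ 2) =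
      π * ((m * z - e ^ 2) / (z ^ 2 * d) - e / z ^ 2) := by
  have hz0 : 0 < z := by linarith
  set P : ℝ → ℝ → ℝ := fun p y => arcsin (((p - m) * (y - m) - r ^ 2) / (r * (p - y))) with hP
  set F : ℝ → ℝ := fun y => (m * z - e ^ 2) / (z ^ 2 * d) * P z y - e / z ^ 2 * P 0 y
    + 1 / z * (√(r ^ 2 - (y - m) ^ 2) / (z - y)) with hF
  have hPcont : ∀ p, (∀ y ∈ Set.Icc (m - r) (m + r), p - y ≠ 0) →
      ContinuousOn (P p) (Set.Icc (m - r) (m + r)) := fun p hp =>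
    continuous_arcsin.comp_continuousOn
      (ContinuousOn.div (by fun_prop) (by fun_prop) fun y hy => mul_ne_zero hr.ne' (hp y hy))
  have hzy : ∀ y ∈ Set.Icc (m - r) (m + r), z - y ≠ 0 := fun y hy => by
    have := hy.2
    linarith
  have hatom : ContinuousOn (fun y => e / z ^ 2 * P 0 y) (Set.Icc (m - r) (m + r)) := by
    rcases he.eq_or_lt with rfl | he
    · simpa using continuousOn_const
    · refine continuousOn_const.mul (hPcont 0 fun y hy => ?_)
      have := hy.1
      have : r < m := by nlinarith
      linarith
  have hcont : ContinuousOn F (Set.Icc (m - r) (m + r)) :=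
    ((continuousOn_const.mul (hPcont z hzy)).sub hatom).add
      (continuousOn_const.mul (ContinuousOn.div (by fun_prop) (by fun_prop) hzy))
  have hderiv : ∀ x ∈ Set.Ioo (m - r) (m + r),
      HasDerivAt F (√(r ^ 2 - (x - m) ^ 2) / (x * (z - x) ^ 2)) x := by
    rintro x ⟨hx1, hx2⟩
    have hx0 : 0 < x := by linarith
    have hzx : 0 < z - x := by linarith
    have hQ : 0 < r ^ 2 - (x - m) ^ 2 := by nlinarith
    have hR : 0 < √(r ^ 2 - (x - m) ^ 2) := sqrt_pos.mpr hQ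
    have hdz : HasDerivAt (P z) (d / ((z - x) * √(r ^ 2 - (x - m) ^ 2))) x := by
      simpa only [abs_of_pos hzx] using hasDerivAt_arcsin_moebius hr hd hd2 hzx.ne' hQ
    have hd0 : HasDerivAt (fun y => e / z ^ 2 * P 0 y)
        (e ^ 2 / (z ^ 2 * (x * √(r ^ 2 - (x - m) ^ 2)))) x := by
      rcases he.eq_or_lt with rfl | he
      · simpa using hasDerivAt_const x (0 : ℝ)
      · have h0 := (hasDerivAt_arcsin_moebius (p := 0) hr he (by rw [he2]; ring)
          (by linarith) hQ).const_mul (e / z ^ 2)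
        rw [zero_sub x, abs_neg, abs_of_pos hx0] at h0
        refine h0.congr_deriv ?_
        field_simp
    refine (((hdz.const_mul ((m * z - e ^ 2) / (z ^ 2 * d))).sub hd0).add
      ((hasDerivAt_sqrt_div_sub hzx.ne' hQ).const_mul (1 / z))).congr_deriv ?_
    have hsq := sq_sqrt hQ.le
    rw [he2]
    field_simp
    rw [hsq]
    ring
  have hle : m - r ≤ m + r := by linarith
  have hint : IntervalIntegrable (fun x => √(r ^ 2 - (x - m) ^ 2) / (x * (z - x) ^ 2))
      MeasureTheory.volume (m - r) (m + r) := by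
    apply intervalIntegrable_deriv_of_nonneg (g := F)
    · rwa [Set.uIcc_of_le hle]
    · rwa [min_eq_left hle, max_eq_right hle]
    · rw [min_eq_left hle, max_eq_right hle]
      rintro x ⟨hx1, -⟩
      have hx0 : 0 < x := by linarith
      positivity
  have hright : ∀ p, p - (m + r) ≠ 0 → P p (m + r) = π / 2 := fun p hp => by
    rw [hP, ← arcsin_one]
    dsimp only
    congr 1
    rw [div_eq_one_iff_eq (mul_ne_zero hr.ne' hp)]
    ring
  have hleft : ∀ p, p - (m - r) ≠ 0 → P p (m - r) = -(π / 2) := fun p hp => by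
    rw [hP, ← arcsin_neg_one]
    dsimp only
    congr 1
    rw [div_eq_iff (mul_ne_zero hr.ne' hp)]
    ring
  have hleft0 : e / z ^ 2 * P 0 (m - r) = e / z ^ 2 * -(π / 2) := by
    rcases he.eq_or_lt with rfl | he
    · simp
    · rw [hleft 0 (by nlinarith)]
  rw [integral_eq_sub_of_hasDerivAt_of_le hle hcont hderiv hint]
  simp only [hF]
  rw [hleft0, hleft z (by linarith), hright z (by linarith), hright 0 (by linarith)]
  simp only [add_sub_cancel_left, sub_sub_cancel_left, neg_sq, sub_self, sqrt_zero]
  ring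

/-- Second-order coefficient of the Laplace phase function at the saddle point: for
`0 < h < √c` and `z₀ = (1+h)(c+h)/h`, integrating `(z₀−λ)⁻²` against the Marchenko–Pastur
distribution `F_c` (atom of mass `max(0, 1−1/c)` at `0` plus density
`√((b_c−x)(x−a_c))/(2πcx)` on `[a_c, b_c]`) gives `h²/(c(1+h)²(c−h²))`. -/
theorem mp_second_derivative_at_saddle (c h : ℝ) (hc : 0 < c) (hh0 : 0 < h)
    (hh : h < Real.sqrt c) :
    max 0 (1 - 1 / c) * (1 / ((1 + h) * (c + h) / h) ^ 2) +
        ∫ x in ((1 - Real.sqrt c) ^ 2)..((1 + Real.sqrt c) ^ 2),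
          Real.sqrt (((1 + Real.sqrt c) ^ 2 - x) * (x - (1 - Real.sqrt c) ^ 2)) /
            (2 * Real.pi * c * x * ((1 + h) * (c + h) / h - x) ^ 2)
      = h ^ 2 / (c * (1 + h) ^ 2 * (c - h ^ 2)) := by
  obtain ⟨s, hs, rfl⟩ : ∃ s, 0 < s ∧ c = s ^ 2 := ⟨√c, sqrt_pos.mpr hc, (sq_sqrt hc.le).symm⟩
  rw [sqrt_sq hs.le] at hh ⊢
  have hsh : 0 < s ^ 2 - h ^ 2 := by nlinarith
  set z : ℝ := (1 + h) * (s ^ 2 + h) / h with hz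
  have hz0 : 0 < z := by positivity
  have hzm : z - (1 + s ^ 2) = h + s ^ 2 / h := by
    rw [hz]
    field_simp
    ring
  have hzr : 1 + s ^ 2 + 2 * s < z := by
    have hgap : h + s ^ 2 / h - 2 * s = (s - h) ^ 2 / h := by
      field_simp
      ring
    have : 0 < (s - h) ^ 2 / h := div_pos (pow_pos (sub_pos.mpr hh) 2) hh0
    linarith
  have hkey := integral_sqrt_div_mul_sub_sq (m := 1 + s ^ 2) (r := 2 * s) (z := z)
    (d := (s ^ 2 - h ^ 2) / h) (e := |1 - s ^ 2|) (by positivity)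
    (by nlinarith [sq_nonneg (1 - s)]) hzr (by positivity)
    (by rw [hzm]; field_simp; ring) (abs_nonneg _) (by rw [sq_abs]; ring)
  have hintegrand : ∀ x : ℝ, √(((1 + s) ^ 2 - x) * (x - (1 - s) ^ 2)) /
      (2 * π * s ^ 2 * x * (z - x) ^ 2) =
      1 / (2 * π * s ^ 2) * (√((2 * s) ^ 2 - (x - (1 + s ^ 2)) ^ 2) / (x * (z - x) ^ 2)) := by
    intro x
    rw [show ((1 + s) ^ 2 - x) * (x - (1 - s) ^ 2) = (2 * s) ^ 2 - (x - (1 + s ^ 2)) ^ 2 by ring,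
      div_mul_div_comm, one_mul, mul_assoc (2 * π * s ^ 2)]
  have hmax : max 0 (1 - 1 / s ^ 2) = (s ^ 2 - 1 + |1 - s ^ 2|) / (2 * s ^ 2) := by
    rcases le_total (s ^ 2) 1 with h1 | h1
    · rw [abs_of_nonneg (by linarith), max_eq_left]
      · ring
      · rw [sub_nonpos, le_div_iff₀ (by positivity)]
        linarith
    · rw [abs_of_nonpos (by linarith), max_eq_right]
      · field_simp
        ring
      · rw [sub_nonneg, div_le_one (by positivity)]
        exact h1
  simp only [hintegrand]
  rw [integral_const_mul, show (1 - s) ^ 2 = 1 + s ^ 2 - 2 * s by ring,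
    show (1 + s) ^ 2 = 1 + s ^ 2 + 2 * s by ring, hkey, hmax, sq_abs]
  have hpi := pi_pos
  have hsum : (s ^ 2 - 1 + |1 - s ^ 2|) / (2 * s ^ 2) * (1 / z ^ 2) + 1 / (2 * π * s ^ 2) *
      (π * (((1 + s ^ 2) * z - (1 - s ^ 2) ^ 2) / (z ^ 2 * ((s ^ 2 - h ^ 2) / h)) -
        |1 - s ^ 2| / z ^ 2)) =
      1 / (2 * s ^ 2 * z ^ 2) * (s ^ 2 - 1 +
        ((1 + s ^ 2) * z - (1 - s ^ 2) ^ 2) * h / (s ^ 2 - h ^ 2)) := by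
    field_simp
    ring
  rw [hsum, hz]
  field_simp
  ring
end

section
/- Let p ≥ 1 be an integer, let j be an integer with 1 ≤ j ≤ p, let a > 0 and z₀ > 0 be real numbers, and let λ_1,…,λ_p be nonnegative real numbers. Then the absolute value of ∫_{−∞}^{z₀} e^{a(x+3iz₀)} (x+3iz₀)^{j−1} ∏_{s=1}^{p} (x+3iz₀−λ_s)^{−1} dx is at most 2^{j−1} (3z₀)^{j−1−p} a^{−1} e^{a z₀}; in particular the integral converges absolutely. The same bound holds with 3iz₀ replaced by −3iz₀. -/
open MeasureTheory Complex

/-- The integrand `e^{az} z^{j−1} ∏ₛ (z−λₛ)⁻¹` appearing in the contour-integral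
representation of the likelihood ratio. -/
noncomputable def hcizIntegrand (p j : ℕ) (a : ℝ) (lam : Fin p → ℝ) (z : ℂ) : ℂ :=
  Complex.exp (a * z) * z ^ (j - 1) * ∏ s : Fin p, (z - (lam s : ℂ))⁻¹

/-- Of the factors `(w i)⁻¹`, `k` are bounded by `K / m` and the remaining ones by `c⁻¹`. -/
theorem pow_mul_prod_inv_le {ι : Type*} (S : Finset ι) (w : ι → ℝ) {m c K : ℝ} {k : ℕ}
    (hk : k ≤ S.card) (hm : 0 ≤ m) (hc : 0 < c) (hcw : ∀ i ∈ S, c ≤ w i)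
    (hmw : ∀ i ∈ S, m ≤ K * w i) :
    m ^ k * ∏ i ∈ S, (w i)⁻¹ ≤ K ^ k * c⁻¹ ^ (S.card - k) := by
  classical
  obtain ⟨T, hTS, rfl⟩ := Finset.exists_subset_card_eq hk
  have hw : ∀ i ∈ S, 0 < w i := fun i hi => hc.trans_le (hcw i hi)
  have hT : m ^ T.card * ∏ i ∈ T, (w i)⁻¹ ≤ K ^ T.card := by
    rw [← Finset.prod_const, ← Finset.prod_mul_distrib, ← Finset.prod_const]
    refine Finset.prod_le_prod (fun i hi => ?_) fun i hi => ?_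
    · exact mul_nonneg hm (inv_nonneg.2 (hw i (hTS hi)).le)
    · rw [← div_eq_mul_inv, div_le_iff₀ (hw i (hTS hi))]
      exact hmw i (hTS hi)
  have hU : ∏ i ∈ S \ T, (w i)⁻¹ ≤ c⁻¹ ^ (S.card - T.card) := by
    rw [← Finset.card_sdiff_of_subset hTS, ← Finset.prod_const]
    refine Finset.prod_le_prod (fun i hi => ?_) fun i hi => ?_
    · exact inv_nonneg.2 (hw i (Finset.sdiff_subset hi)).le
    · exact inv_anti₀ hc (hcw i (Finset.sdiff_subset hi))
  have hT0 : 0 ≤ m ^ T.card * ∏ i ∈ T, (w i)⁻¹ :=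
    mul_nonneg (pow_nonneg hm _)
      (Finset.prod_nonneg fun i hi => inv_nonneg.2 (hw i (hTS hi)).le)
  have hU0 : 0 ≤ ∏ i ∈ S \ T, (w i)⁻¹ :=
    Finset.prod_nonneg fun i hi => inv_nonneg.2 (hw i (Finset.sdiff_subset hi)).le
  calc m ^ T.card * ∏ i ∈ S, (w i)⁻¹
      = (m ^ T.card * ∏ i ∈ T, (w i)⁻¹) * ∏ i ∈ S \ T, (w i)⁻¹ := by
        rw [← Finset.prod_sdiff hTS]; ring
    _ ≤ K ^ T.card * c⁻¹ ^ (S.card - T.card) := mul_le_mul hT hU hU0 (hT0.trans hT)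

theorem norm_le_two_mul_norm_sub_ofReal {z : ℂ} {z₀ l : ℝ} (hl : 0 ≤ l)
    (hre : z.re ≤ z₀) (him : |z.im| = 3 * z₀) : ‖z‖ ≤ 2 * ‖z - l‖ := by
  refine le_of_sq_le_sq ?_ (by positivity)
  have h : z.im ^ 2 = 9 * z₀ ^ 2 := by rw [← sq_abs, him]; ring
  rw [mul_pow, Complex.sq_norm, Complex.sq_norm, normSq_apply, normSq_apply]
  simp only [sub_re, sub_im, ofReal_re, ofReal_im, sub_zero]
  rcases le_total z.re 0 with h0 | h0
  · nlinarith [mul_nonneg (neg_nonneg.2 h0) hl, sq_nonneg l, sq_nonneg z.im, sq_nonneg z.re]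
  · nlinarith [mul_self_le_mul_self h0 hre, sq_nonneg (z.re - l), sq_nonneg z₀]

theorem norm_hcizIntegrand_le {p j : ℕ} (hj1 : 1 ≤ j) (hjp : j ≤ p) {a z₀ : ℝ} (hz : 0 < z₀)
    {lam : Fin p → ℝ} (hlam : ∀ s, 0 ≤ lam s) {z : ℂ} (hre : z.re ≤ z₀)
    (him : |z.im| = 3 * z₀) :
    ‖hcizIntegrand p j a lam z‖ ≤
      2 ^ (j - 1) * (3 * z₀) ^ ((j : ℤ) - 1 - (p : ℤ)) * Real.exp (a * z.re) := by
  have hexp : (3 * z₀) ^ ((j : ℤ) - 1 - (p : ℤ)) = (3 * z₀)⁻¹ ^ (p - (j - 1)) := by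
    rw [inv_pow, ← zpow_natCast, ← zpow_neg]
    congr 1
    omega
  have hdist : ∀ s ∈ Finset.univ, 3 * z₀ ≤ ‖z - lam s‖ := fun s _ => by
    simpa [him] using abs_im_le_norm (z - lam s)
  have hmain := pow_mul_prod_inv_le (k := j - 1) Finset.univ (fun s => ‖z - lam s‖)
    (by rw [Finset.card_fin]; omega) (norm_nonneg z) (by positivity : 0 < 3 * z₀) hdist
    fun s _ => norm_le_two_mul_norm_sub_ofReal (hlam s) hre him
  rw [Finset.card_fin] at hmain
  have hnorm : ‖hcizIntegrand p j a lam z‖ =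
      (‖z‖ ^ (j - 1) * ∏ s, ‖z - lam s‖⁻¹) * Real.exp (a * z.re) := by
    simp only [hcizIntegrand, norm_mul, norm_pow, norm_prod, norm_inv, Complex.norm_exp,
      re_ofReal_mul]
    ring
  rw [hnorm, hexp]
  gcongr

theorem integrableOn_and_norm_integral_hcizIntegrand_le {p j : ℕ} (hj1 : 1 ≤ j) (hjp : j ≤ p)
    {a z₀ : ℝ} (ha : 0 < a) (hz : 0 < z₀) {lam : Fin p → ℝ} (hlam : ∀ s, 0 ≤ lam s)
    {w : ℂ} (hre : w.re = 0) (him : |w.im| = 3 * z₀) :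
    IntegrableOn (fun x : ℝ => hcizIntegrand p j a lam (x + w)) (Set.Iic z₀) volume ∧
      ‖∫ x in Set.Iic z₀, hcizIntegrand p j a lam ((x : ℂ) + w)‖ ≤
        2 ^ (j - 1) * (3 * z₀) ^ ((j : ℤ) - 1 - (p : ℤ)) * a⁻¹ * Real.exp (a * z₀) := by
  set C : ℝ := 2 ^ (j - 1) * (3 * z₀) ^ ((j : ℤ) - 1 - (p : ℤ))
  have hbound : ∀ᵐ x : ℝ ∂volume.restrict (Set.Iic z₀),
      ‖hcizIntegrand p j a lam (x + w)‖ ≤ C * Real.exp (a * x) := by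
    filter_upwards [ae_restrict_mem measurableSet_Iic] with x hx
    simpa [hre] using norm_hcizIntegrand_le (a := a) (z := x + w) hj1 hjp hz hlam
      (by simpa [hre] using hx) (by simpa using him)
  have hint : IntegrableOn (fun x : ℝ => C * Real.exp (a * x)) (Set.Iic z₀) :=
    (integrableOn_exp_mul_Iic ha z₀).const_mul C
  have hmeas : Measurable fun x : ℝ => hcizIntegrand p j a lam (x + w) := by
    unfold hcizIntegrand
    fun_prop
  refine ⟨hint.mono' hmeas.aestronglyMeasurable hbound,
    (norm_integral_le_of_norm_le hint hbound).trans_eq ?_⟩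
  rw [integral_const_mul, integral_exp_mul_Iic ha]
  ring

/-- Tail bound from the proof of Lemma 3: the integral of
`e^{az} z^{j−1} ∏ₛ(z−λₛ)⁻¹` along the horizontal ray `{x ± 3iz₀ : x ≤ z₀}` converges
absolutely and is bounded in absolute value by `2^{j−1} (3z₀)^{j−1−p} a⁻¹ e^{a z₀}`. -/
theorem tail_bound_horizontal_ray (p j : ℕ) (hp : 1 ≤ p) (hj1 : 1 ≤ j) (hjp : j ≤ p)
    (a z₀ : ℝ) (ha : 0 < a) (hz : 0 < z₀) (lam : Fin p → ℝ) (hlam : ∀ s, 0 ≤ lam s) :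
    (IntegrableOn (fun x : ℝ => hcizIntegrand p j a lam ((x : ℂ) + 3 * z₀ * Complex.I))
        (Set.Iic z₀) volume ∧
      ‖∫ x in Set.Iic z₀, hcizIntegrand p j a lam ((x : ℂ) + 3 * z₀ * Complex.I)‖ ≤
        2 ^ (j - 1) * (3 * z₀) ^ ((j : ℤ) - 1 - (p : ℤ)) * a⁻¹ * Real.exp (a * z₀)) ∧
    (IntegrableOn (fun x : ℝ => hcizIntegrand p j a lam ((x : ℂ) - 3 * z₀ * Complex.I))
        (Set.Iic z₀) volume ∧
      ‖∫ x in Set.Iic z₀, hcizIntegrand p j a lam ((x : ℂ) - 3 * z₀ * Complex.I)‖ ≤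
        2 ^ (j - 1) * (3 * z₀) ^ ((j : ℤ) - 1 - (p : ℤ)) * a⁻¹ * Real.exp (a * z₀)) := by
  refine ⟨integrableOn_and_norm_integral_hcizIntegrand_le hj1 hjp ha hz hlam (by simp)
    (by simp [abs_of_pos hz]), ?_⟩
  simp only [sub_eq_add_neg (_ : ℂ) (3 * z₀ * Complex.I)]
  exact integrableOn_and_norm_integral_hcizIntegrand_le hj1 hjp ha hz hlam (by simp)
    (by simp [abs_of_pos hz])
end

section
/- Let c > 0 and h > 0 be real numbers, set x = −h/(h+c), and let ρ be a real number with h/(h+c) < ρ < 1. Then (1/(2πi)) ∮_{|m|=ρ} ( −1/m + c/(1+m) )² · ( 1/m − 1/(m−x) ) dm = −h(h+2+2c), where the circle is traversed counterclockwise. Equivalently, the sum of the residues of the function m ↦ (−1/m + c/(1+m))²(1/m − 1/(m−x)) at m = 0 and m = x equals −h(h+2+2c). -/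
open Complex Metric

/-- Partial fraction decomposition of `z(m)² (1/m − 1/(m−x))`, where `x = −h/(h+c)`. -/
lemma residue_integrand_partial_fractions {c h m : ℂ} (hh : h ≠ 0) (hhc : h + c ≠ 0)
    (hm : m ≠ 0) (hm₁ : 1 + m ≠ 0) (hmx : m - -h / (h + c) ≠ 0) :
    (-(1 / m) + c / (1 + m)) ^ 2 * (1 / m - 1 / (m - -h / (h + c))) =
      (2 * c + c ^ 2 + ((h + c) / h) ^ 2 + 2 * c * ((h + c) / h)) * (m - 0)⁻¹ +
        -((h + c) / h + h + c) ^ 2 * (m - -h / (h + c))⁻¹ +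
        (-2 * c - (h + c) / h) * (m - 0) ^ (-2 : ℤ) + (m - 0) ^ (-3 : ℤ) +
        ((2 * h + h ^ 2 + 2 * h * c) / (1 + m) + c * h / (1 + m) ^ 2) := by
  have hmx' : m * (h + c) + h ≠ 0 := by
    intro h0
    apply hmx
    field_simp
    linear_combination h0
  have hx : m - -h / (h + c) = (m * (h + c) + h) / (h + c) := by
    field_simp
    ring
  have h2 : m ^ (-2 : ℤ) = 1 / m ^ 2 := by simp [zpow_neg]
  have h3 : m ^ (-3 : ℤ) = 1 / m ^ 3 := by simp [zpow_neg]
  rw [sub_zero, h2, h3, hx]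
  field_simp
  ring

/-- Residue computation from Lemma A3 of the paper: with `z(m) = −1/m + c/(1+m)` and
`x = −h/(h+c)`, for any radius `h/(h+c) < ρ < 1`,
`(2πi)⁻¹ ∮_{|m|=ρ} z(m)² (1/m − 1/(m−x)) dm = −h(h+2+2c)`. -/
theorem residue_cov_xi_zeta (c h : ℝ) (hc : 0 < c) (hh : 0 < h) (ρ : ℝ)
    (hρ₁ : h / (h + c) < ρ) (hρ₂ : ρ < 1) :
    (2 * Real.pi * Complex.I)⁻¹ *
        (∮ m in C((0 : ℂ), ρ),
          (-(1 / m) + (c : ℂ) / (1 + m)) ^ 2 *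
            (1 / m - 1 / (m - (-(h : ℂ) / ((h : ℂ) + (c : ℂ))))))
      = -(h : ℂ) * ((h : ℂ) + 2 + 2 * (c : ℂ)) := by
  have hhC : (h : ℂ) ≠ 0 := by exact_mod_cast hh.ne'
  have hhcC : (h : ℂ) + c ≠ 0 := by exact_mod_cast (add_pos hh hc).ne'
  have hρ : 0 < ρ := (div_pos hh (add_pos hh hc)).trans hρ₁
  set x : ℂ := -(h : ℂ) / ((h : ℂ) + (c : ℂ)) with hx
  have hx_ball : x ∈ ball (0 : ℂ) ρ := by
    have hx' : x = ((-(h / (h + c)) : ℝ) : ℂ) := by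
      rw [hx]
      push_cast
      ring
    rwa [mem_ball_zero_iff, hx', norm_real, norm_neg, Real.norm_of_nonneg (by positivity)]
  have h0_sphere : (0 : ℂ) ∉ sphere (0 : ℂ) |ρ| := by simpa using (abs_pos.2 hρ.ne').ne
  have hx_sphere : x ∉ sphere (0 : ℂ) |ρ| := by
    rw [abs_of_pos hρ]
    exact fun h' => (mem_ball.1 hx_ball).ne (mem_sphere.1 h')
  have h_one : ∀ m ∈ closedBall (0 : ℂ) ρ, 1 + m ≠ 0 := by
    intro m hm h'
    rw [eq_neg_of_add_eq_zero_right h', mem_closedBall_zero_iff, norm_neg, norm_one] at hm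
    linarith
  have h_diff : DifferentiableOn ℂ
      (fun m : ℂ => (2 * h + h ^ 2 + 2 * h * c : ℂ) / (1 + m) + (c * h : ℂ) / (1 + m) ^ 2)
      (closedBall 0 ρ) := by
    intro m hm
    have := h_one m hm
    apply DifferentiableAt.differentiableWithinAt
    fun_prop (disch := simp [this])
  have h_hol := (h_diff.mono closure_ball_subset_closedBall).diffContOnCl.circleIntegral_eq_zero
    hρ.le
  have int_inv (a w : ℂ) (hw : w ∉ sphere (0 : ℂ) |ρ|) :
      CircleIntegrable (fun m => a * (m - w)⁻¹) 0 ρ :=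
    (circleIntegrable_sub_inv_iff.2 (Or.inr hw)).const_smul
  have int_zpow (n : ℤ) : CircleIntegrable (fun m : ℂ => (m - 0) ^ n) 0 ρ :=
    circleIntegrable_sub_zpow_iff.2 (Or.inr (Or.inr h0_sphere))
  have int_mul_zpow (a : ℂ) (n : ℤ) : CircleIntegrable (fun m : ℂ => a * (m - 0) ^ n) 0 ρ :=
    (int_zpow n).const_smul
  have int_hol := (h_diff.continuousOn.mono sphere_subset_closedBall).circleIntegrable hρ.le
  rw [circleIntegral.integral_congr hρ.le fun m hm =>
      residue_integrand_partial_fractions hhC hhcC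
        (ne_zero_of_mem_sphere hρ.ne' ⟨m, hm⟩) (h_one m (sphere_subset_closedBall hm))
        (sub_ne_zero.2 fun h' => hx_sphere (by rwa [abs_of_pos hρ, hx, ← h'])),
    circleIntegral.integral_add _ int_hol, circleIntegral.integral_add _ (int_zpow _),
    circleIntegral.integral_add _ (int_mul_zpow _ _),
    circleIntegral.integral_add (int_inv _ _ h0_sphere) (int_inv _ _ hx_sphere),
    h_hol]
  · simp only [circleIntegral.integral_const_mul]
    rw [circleIntegral.integral_sub_inv_of_mem_ball (mem_ball_self hρ),
      circleIntegral.integral_sub_inv_of_mem_ball hx_ball,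
      circleIntegral.integral_sub_zpow_of_ne (by norm_num),
      circleIntegral.integral_sub_zpow_of_ne (by norm_num)]
    have := Real.pi_ne_zero
    field_simp
    ring
  · exact (int_inv _ _ h0_sphere).add (int_inv _ _ hx_sphere)
  · exact ((int_inv _ _ h0_sphere).add (int_inv _ _ hx_sphere)).add (int_mul_zpow _ _)
  · exact (((int_inv _ _ h0_sphere).add (int_inv _ _ hx_sphere)).add
      (int_mul_zpow _ _)).add (int_zpow _)
end

section
/- Fix an integer r ≥ 1 and a real number c > 0, and let (p_n)_{n≥1} be a sequence of positive integers such that p_n/n → c as n → ∞. Then Γ( n·p_n − p_n·r + r(r+1)/2 ) / Γ( n·p_n ) · (n·p_n)^{p_n·r − r(r+1)/2} → e^{c r²/2} as n → ∞. -/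
open Filter Real Topology

/-- One step of the recursion `Γ(x - m + 1) = (x - m) Γ(x - m)` in normalised form. -/
lemma gamma_sub_ratio_succ (x : ℝ) (k : ℕ) (hk : ((k + 1 : ℕ) : ℝ) < x) :
    Real.Gamma (x - (k + 1 : ℕ)) / Real.Gamma x * x ^ (k + 1) =
      Real.Gamma (x - k) / Real.Gamma x * x ^ k * (x / (x - (k + 1 : ℕ))) := by
  have hne : x - (k + 1 : ℕ) ≠ 0 := (sub_pos.2 hk).ne'
  have hrec := Real.Gamma_add_one hne
  have harg : x - ((k + 1 : ℕ) : ℝ) + 1 = x - k := by push_cast; ring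
  rw [harg] at hrec
  rw [hrec, pow_succ]
  field_simp

/-- Lower bound for `Γ(x - k) x ^ k / Γ(x)`. -/
lemma exp_le_gamma_sub_ratio (x : ℝ) (k : ℕ) (hk : (k : ℝ) < x) :
    Real.exp ((k : ℝ) * (k + 1) / (2 * x)) ≤
      Real.Gamma (x - k) / Real.Gamma x * x ^ k := by
  have hx : 0 < x := (Nat.cast_nonneg k).trans_lt hk
  induction k with
  | zero => simp [(Real.Gamma_pos_of_pos hx).ne']
  | succ k ih =>
    have hlt : (k : ℝ) < x := by push_cast at hk; linarith
    have hsub : 0 < x - (k + 1 : ℕ) := sub_pos.2 hk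
    rw [gamma_sub_ratio_succ x k hk]
    have hstep : Real.exp (((k + 1 : ℕ) : ℝ) / x) ≤ x / (x - (k + 1 : ℕ)) := by
      have h := Real.add_one_le_exp (-(((k + 1 : ℕ) : ℝ) / x))
      rw [Real.exp_neg] at h
      rw [← inv_div (x - (k + 1 : ℕ)) x, le_inv_comm₀ (Real.exp_pos _) (div_pos hsub hx)]
      refine le_trans (le_of_eq ?_) h
      field_simp
      ring
    calc Real.exp (((k + 1 : ℕ) : ℝ) * ((k + 1 : ℕ) + 1) / (2 * x))
        = Real.exp ((k : ℝ) * (k + 1) / (2 * x)) * Real.exp (((k + 1 : ℕ) : ℝ) / x) := by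
          rw [← Real.exp_add]
          congr 1
          push_cast
          field_simp
          ring
      _ ≤ _ := mul_le_mul (ih hlt) hstep (Real.exp_pos _).le
          ((Real.exp_pos _).le.trans (ih hlt))

/-- Upper bound for `Γ(x - k) x ^ k / Γ(x)`. -/
lemma gamma_sub_ratio_le_exp (x : ℝ) (k : ℕ) (hk : (k : ℝ) < x) :
    Real.Gamma (x - k) / Real.Gamma x * x ^ k ≤
      Real.exp ((k : ℝ) * (k + 1) / (2 * (x - k))) := by
  have hx : 0 < x := (Nat.cast_nonneg k).trans_lt hk
  induction k with
  | zero => simp [(Real.Gamma_pos_of_pos hx).ne']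
  | succ k ih =>
    have hlt : (k : ℝ) < x := by push_cast at hk; linarith
    have hsub : 0 < x - (k + 1 : ℕ) := sub_pos.2 hk
    rw [gamma_sub_ratio_succ x k hk]
    have hstep : x / (x - (k + 1 : ℕ)) ≤
        Real.exp (((k + 1 : ℕ) : ℝ) / (x - (k + 1 : ℕ))) := by
      refine le_trans (le_of_eq ?_) (Real.add_one_le_exp _)
      field_simp
      ring
    have hmono : Real.exp ((k : ℝ) * (k + 1) / (2 * (x - k))) ≤
        Real.exp ((k : ℝ) * (k + 1) / (2 * (x - (k + 1 : ℕ)))) := by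
      gcongr
      simp
    calc _ ≤ Real.exp ((k : ℝ) * (k + 1) / (2 * (x - (k + 1 : ℕ)))) *
          Real.exp (((k + 1 : ℕ) : ℝ) / (x - (k + 1 : ℕ))) :=
          mul_le_mul ((ih hlt).trans hmono) hstep (div_pos hx hsub).le (Real.exp_pos _).le
      _ = _ := by
          rw [← Real.exp_add]
          congr 1
          generalize hy : x - ((k + 1 : ℕ) : ℝ) = y at hsub
          push_cast
          field_simp
          ring

/-- Squeeze criterion: if `k < x` eventually, `k (k + 1) / (2 x) → a` and `k / x → 0`, then
`Γ(x - k) x ^ k / Γ(x) → exp a`. -/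
lemma tendsto_gamma_sub_ratio {ι : Type*} {l : Filter ι} {x : ι → ℝ} {k : ι → ℕ} {a : ℝ}
    (hx : ∀ᶠ i in l, (k i : ℝ) < x i)
    (ha : Tendsto (fun i => (k i : ℝ) * (k i + 1) / (2 * x i)) l (𝓝 a))
    (hkx : Tendsto (fun i => (k i : ℝ) / x i) l (𝓝 0)) :
    Tendsto (fun i => Real.Gamma (x i - k i) / Real.Gamma (x i) * x i ^ k i) l
      (𝓝 (Real.exp a)) := by
  have hupper : Tendsto (fun i => (k i : ℝ) * (k i + 1) / (2 * (x i - k i))) l (𝓝 a) := by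
    have h := ha.div (hkx.const_sub 1) (by norm_num)
    rw [sub_zero, div_one] at h
    refine h.congr' ?_
    filter_upwards [hx] with i hi
    have hpos : 0 < x i := (Nat.cast_nonneg _).trans_lt hi
    have hsub : x i - k i ≠ 0 := (sub_pos.2 hi).ne'
    simp only [Pi.div_apply]
    field_simp
  refine tendsto_of_tendsto_of_tendsto_of_le_of_le'
    ((Real.continuous_exp.tendsto a).comp ha) ((Real.continuous_exp.tendsto a).comp hupper) ?_ ?_
  · filter_upwards [hx] with i hi using exp_le_gamma_sub_ratio _ _ hi
  · filter_upwards [hx] with i hi using gamma_sub_ratio_le_exp _ _ hi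

/-- Stirling-type asymptotics used in the proof of Theorem 1: if `p_n/n → c > 0`, then
`Γ(np_n − p_n r + r(r+1)/2)/Γ(np_n) · (np_n)^{p_n r − r(r+1)/2} → e^{c r²/2}`
as `n → ∞`. -/
theorem gamma_ratio_limit (r : ℕ) (hr : 1 ≤ r) (c : ℝ) (hc : 0 < c)
    (p : ℕ → ℕ) (hp : ∀ n, 0 < p n)
    (hlim : Tendsto (fun n : ℕ => (p n : ℝ) / (n : ℝ)) atTop (𝓝 c)) :
    Tendsto (fun n : ℕ =>
        Real.Gamma ((n : ℝ) * (p n : ℝ) - (p n : ℝ) * (r : ℝ) + ((r * (r + 1) / 2 : ℕ) : ℝ)) /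
          Real.Gamma ((n : ℝ) * (p n : ℝ)) *
          ((n : ℝ) * (p n : ℝ)) ^ ((p n : ℝ) * (r : ℝ) - ((r * (r + 1) / 2 : ℕ) : ℝ)))
      atTop (𝓝 (Real.exp (c * (r : ℝ) ^ 2 / 2))) := by
  generalize r * (r + 1) / 2 = s
  have hpR : ∀ n, (0 : ℝ) < p n := fun n => Nat.cast_pos.2 (hp n)
  have hn : Tendsto (fun n : ℕ => (n : ℝ)) atTop atTop := tendsto_natCast_atTop_atTop
  have hp_top : Tendsto (fun n => (p n : ℝ)) atTop atTop := by
    refine (hlim.pos_mul_atTop hc hn).congr' ?_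
    filter_upwards [eventually_gt_atTop 0] with n hn0
    field_simp
  have hs : ∀ᶠ n in atTop, s ≤ p n * r := by
    filter_upwards [hp_top.eventually_ge_atTop (s : ℝ)] with n h
    exact (Nat.cast_le.1 h).trans (Nat.le_mul_of_pos_right _ hr)
  have hcast : ∀ᶠ n in atTop, ((p n * r - s : ℕ) : ℝ) = (p n : ℝ) * r - s := by
    filter_upwards [hs] with n h
    push_cast [Nat.cast_sub h]
    rfl
  have hsp : Tendsto (fun n => (r : ℝ) - s / p n) atTop (𝓝 r) := by
    simpa using (hp_top.const_div_atTop (s : ℝ)).const_sub (r : ℝ)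
  have hlt : ∀ᶠ n : ℕ in atTop, ((p n * r - s : ℕ) : ℝ) < (n : ℝ) * p n := by
    filter_upwards [eventually_gt_atTop r] with n h
    have : p n * r - s < n * p n :=
      (Nat.sub_le _ _).trans_lt (by rw [mul_comm]; exact Nat.mul_lt_mul_of_pos_right h (hp n))
    exact_mod_cast this
  have hkx : Tendsto (fun n : ℕ => ((p n * r - s : ℕ) : ℝ) / ((n : ℝ) * p n)) atTop (𝓝 0) := by
    refine (hsp.div_atTop hn).congr' ?_
    filter_upwards [hcast, eventually_gt_atTop 0] with n h hn0
    have := hpR n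
    rw [h]
    field_simp
  have hsum : Tendsto (fun n : ℕ => ((p n * r - s : ℕ) : ℝ) * ((p n * r - s : ℕ) + 1) /
      (2 * ((n : ℝ) * p n))) atTop (𝓝 (c * (r : ℝ) ^ 2 / 2)) := by
    have h := (hsp.mul ((hlim.mul_const (r : ℝ)).sub
      (hn.const_div_atTop ((s : ℝ) - 1)))).div_const 2
    rw [show (r : ℝ) * (c * r - 0) / 2 = c * (r : ℝ) ^ 2 / 2 by ring] at h
    refine h.congr' ?_
    filter_upwards [hcast, eventually_gt_atTop 0] with n h hn0
    have := hpR n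
    rw [h]
    field_simp
    ring
  refine (tendsto_gamma_sub_ratio hlt hsum hkx).congr' ?_
  filter_upwards [hcast] with n h
  rw [← Real.rpow_natCast, h]
  congr 3
  ring
end
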